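/- arXiv:1710.02440 — 2 statements merged into one kernel-verified Lean document; each statement's English description precedes it below -/
import Mathlib

section
/- Let n > 2k ≥ 6. Let (S_l, T_l) be a resistant pair, and let T_{l−1} be the ⪯-greatest set strictly ⪯-preceding T_l that belongs to some resistant pair (if no resistant pair precedes T_l, use the convention |L(T_{l−1},k)| = 0). Then any cross-intersecting pair of families A ⊆ {A ⊆ [2,n] : |A| = k−1} and B ⊆ {B ⊆ [2,n] : |B| = k} with |L(T_{l−1},k)| < |B| ≤ |L(T_l,k)| satisfies |A| + |B| ≤ |L(S_l,k−1)| + |L(T_l,k)|. Consequently, every intersecting family F of k-element subsets of [n] with |L(T_{l−1},k)| < γ(F) ≤ |L(T_l,k)| satisfies |F| ≤ |L(S_l,k−1)| + |L(T_l,k)|. -/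
open Finset

def IntersectingFam (F : Finset (Finset ℕ)) : Prop :=
  ∀ A ∈ F, ∀ B ∈ F, (A ∩ B).Nonempty

def CrossIntersecting (𝒜 ℬ : Finset (Finset ℕ)) : Prop :=
  ∀ A ∈ 𝒜, ∀ B ∈ ℬ, (A ∩ B).Nonempty

/-- The degree of an element `i`: the number of sets of `F` containing `i`. -/
def famDeg (F : Finset (Finset ℕ)) (i : ℕ) : ℕ := (F.filter (fun A => i ∈ A)).card

/-- The maximal degree `Δ(F)` over the ground set `[n]`. -/
def maxDeg (n : ℕ) (F : Finset (Finset ℕ)) : ℕ := (Finset.Icc 1 n).sup (famDeg F)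

/-- The diversity `γ(F) = |F| − Δ(F)`. -/
def diversity (n : ℕ) (F : Finset (Finset ℕ)) : ℕ := F.card - maxDeg n F

/-- The degree of a subset `S`: the number of sets of `F` containing `S`. -/
def tDeg (F : Finset (Finset ℕ)) (S : Finset ℕ) : ℕ := (F.filter (fun A => S ⊆ A)).card

/-- Lexicographic order: `A ⪯ B` iff `A ⊇ B` or `min (A \ B) < min (B \ A)`. -/
def lexLE (A B : Finset ℕ) : Prop := B ⊆ A ∨ (A \ B).min < (B \ A).min

instance : DecidableRel lexLE := fun A B => by unfold lexLE; exact inferInstance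

def lexLT (A B : Finset ℕ) : Prop := lexLE A B ∧ A ≠ B

/-- Lex family with characteristic set `X` on ground set `[2,n]`:
`L(X,a) = {A ⊆ [2,n] : |A| = a, A ⪯ X ∩ [2,n]}`. -/
def lexFam (n a : ℕ) (X : Finset ℕ) : Finset (Finset ℕ) :=
  ((Finset.Icc 2 n).powersetCard a).filter (fun A => lexLE A (X ∩ Finset.Icc 2 n))

/-- Lex family with characteristic set `X` on ground set `[n]`:
`L(X,c) = {A ⊆ [n] : |A| = c, A ⪯ X}`. -/
def lexFam1 (n c : ℕ) (X : Finset ℕ) : Finset (Finset ℕ) :=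
  ((Finset.Icc 1 n).powersetCard c).filter (fun A => lexLE A X)

/-- Resistant pairs for uniformity `k` on ground set `[n]`. -/
def ResistantPair (n k : ℕ) (S T : Finset ℕ) : Prop :=
  (S = ({1, 4} : Finset ℕ) ∧ T = ({2, 3, 4} : Finset ℕ)) ∨
  (1 ∈ S ∧ S ⊆ Finset.Icc 1 n ∧ T ⊆ Finset.Icc 2 n ∧
    ∃ j : ℕ, T.max = (j : WithTop ℕ) ∧ S ∩ T = {j} ∧ S ∪ T = Finset.Icc 1 j ∧
      S.card ≤ k ∧ T.card ≤ k ∧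
      ∀ i : ℕ, 4 ≤ i → i ≤ j → (Finset.Icc 1 i ∩ S).card < (Finset.Icc 1 i \ S).card)

/-- `(a,b)`-resistant pairs on ground set `[n]`. -/
def ABResistantPair (n a b : ℕ) (S T : Finset ℕ) : Prop :=
  (T = Finset.Icc 1 (b - a + 2) ∧ S = ({1, b - a + 2} : Finset ℕ)) ∨
  (S ⊆ Finset.Icc 1 n ∧ T ⊆ Finset.Icc 1 n ∧
    ∃ j : ℕ, T.max = (j : WithTop ℕ) ∧ S ∩ T = {j} ∧ S ∪ T = Finset.Icc 1 j ∧
      S.card ≤ a ∧ T.card ≤ b ∧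
      ∀ i : ℕ, b - a + 2 ≤ i → i ≤ j →
        ((Finset.Icc 1 i ∩ S).card : ℤ) - (a : ℤ) < ((Finset.Icc 1 i \ S).card : ℤ) - (b : ℤ))

/-- Resistant numbers: `γ` is resistant if in its `(n−k−1)`-cascade form
`γ = Σ_{i=1}^s C(n−b_i, n−k−i)` (with `1 ≤ b_1 < … < b_s`) one has `|S_γ| ≤ k`,
`s ≤ k−1` and `b_i > 2i+2` for each `i`; in addition `C(n−4,k−3)` is resistant. -/
def IsResistantNum (n k γ : ℕ) : Prop :=
  γ = Nat.choose (n - 4) (k - 3) ∨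
  ∃ (s : ℕ) (b : ℕ → ℕ), 1 ≤ s ∧ 1 ≤ b 1 ∧
    (∀ i j, 1 ≤ i → i < j → j ≤ s → b i < b j) ∧
    γ = ∑ i ∈ Finset.Icc 1 s, Nat.choose (n - b i) (n - k - i) ∧
    s ≤ k - 1 ∧
    (insert (b s) (Finset.Icc 2 (b s) \ (Finset.Icc 1 s).image b)).card ≤ k ∧
    (∀ i, 1 ≤ i → i ≤ s → b i > 2 * i + 2)

/-- The family `J_i`. -/
def Jfam (n k i : ℕ) : Finset (Finset ℕ) :=
  {Finset.Icc 2 (k+1), Finset.Icc (i+1) (k+i)} ∪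
    ((Finset.Icc 1 n).powersetCard k).filter
      (fun F => 1 ∈ F ∧ (F ∩ Finset.Icc 2 (k+1)).Nonempty ∧ (F ∩ Finset.Icc (i+1) (k+i)).Nonempty)

/-- Two families are isomorphic if one is obtained from the other by a permutation
of the ground set `[n]`. -/
def IsomorphicFam (n : ℕ) (F G : Finset (Finset ℕ)) : Prop :=
  ∃ σ : Equiv.Perm ℕ, (Finset.Icc 1 n).image σ = Finset.Icc 1 n ∧
    F.image (fun A => A.image σ) = G

/-- `F` is isomorphic to a subfamily of `G`. -/
def IsoSubfamily (n : ℕ) (F G : Finset (Finset ℕ)) : Prop :=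
  ∃ σ : Equiv.Perm ℕ, (Finset.Icc 1 n).image σ = Finset.Icc 1 n ∧
    F.image (fun A => A.image σ) ⊆ G

/-- `L` is an initial segment of the lex order on `k`-subsets of `[2,n]`. -/
def IsInitialSeg (n k : ℕ) (L : Finset (Finset ℕ)) : Prop :=
  L ⊆ (Finset.Icc 2 n).powersetCard k ∧
  ∀ A ∈ L, ∀ B ∈ (Finset.Icc 2 n).powersetCard k, lexLE B A → B ∈ L

/-- The maximal intersecting family `F_l` whose sets avoiding `1` are exactly `L`. -/
def maxFam (n k : ℕ) (L : Finset (Finset ℕ)) : Finset (Finset ℕ) :=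
  L ∪ ((Finset.Icc 1 n).powersetCard k).filter
    (fun A => 1 ∈ A ∧ ∀ B ∈ L, (A ∩ B).Nonempty)

/-- The sets `T` allowed in the recursive definition of a `T_l`-neutral pair:
`T_l` is allowed, and whenever `T'` is allowed so is `T' ∪ {2|T'|}`. -/
inductive NeutralSet (T0 : Finset ℕ) : Finset ℕ → Prop
  | base : NeutralSet T0 T0
  | step (T' : Finset ℕ) : NeutralSet T0 T' → NeutralSet T0 (insert (2 * T'.card) T')

/-- The family `A_0(n,k,s)`. -/
def A0fam (n k s : ℕ) : Finset (Finset ℕ) :=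
  ((Finset.Icc 1 n).powersetCard k).filter (fun A => (A ∩ Finset.Icc 1 s).Nonempty)

lemma lexLE_iff_forall {A B : Finset ℕ} :
    lexLE A B ↔ ∀ a ∈ B, a ∉ A → ∃ b ∈ A, b ∉ B ∧ b ≤ a := by
  unfold lexLE
  constructor
  · rintro (h | h) a haB haA
    · exact absurd (h haB) haA
    · have h1 : (B \ A).min ≤ (a : WithTop ℕ) := Finset.min_le (by simp [haB, haA])
      obtain ⟨b, hb⟩ := Finset.min_of_nonempty (s := A \ B) (by
        rw [Finset.nonempty_iff_ne_empty]
        intro h0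
        simp [h0] at h)
      have hb' := Finset.mem_of_min hb
      rw [Finset.mem_sdiff] at hb'
      refine ⟨b, hb'.1, hb'.2, ?_⟩
      rw [hb] at h
      exact WithTop.coe_le_coe.1 (h.le.trans h1)
  · intro h
    by_cases hBA : B ⊆ A
    · exact Or.inl hBA
    · right
      obtain ⟨a, ha⟩ := Finset.min_of_nonempty (s := B \ A) (Finset.sdiff_nonempty.2 hBA)
      have ha' := Finset.mem_of_min ha
      rw [Finset.mem_sdiff] at ha'
      obtain ⟨b, hbA, hbB, hba⟩ := h a ha'.1 ha'.2
      rw [ha]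
      refine (Finset.min_le (Finset.mem_sdiff.2 ⟨hbA, hbB⟩)).trans_lt ?_
      refine WithTop.coe_lt_coe.2 (lt_of_le_of_ne hba ?_)
      rintro rfl
      exact hbB ha'.1

/-- The colex key of a set for the reversed order on `ℕ`; larger keys come earlier in `lexLE`. -/
def lexKey (A : Finset ℕ) : Colex (Finset ℕᵒᵈ) :=
  toColex (A.map OrderDual.toDual.toEmbedding)

lemma lexLE_iff_lexKey {A B : Finset ℕ} : lexLE A B ↔ lexKey B ≤ lexKey A := by
  rw [lexLE_iff_forall, lexKey, lexKey, Finset.Colex.toColex_le_toColex]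
  simp [OrderDual.forall, OrderDual.exists]

lemma lexKey_injective : Function.Injective lexKey := fun A B h => by
  simpa [lexKey] using h

lemma lexLE_trans {A B C : Finset ℕ} (h : lexLE A B) (h' : lexLE B C) : lexLE A C := by
  rw [lexLE_iff_lexKey] at *
  exact h'.trans h

lemma lexLE_total (A B : Finset ℕ) : lexLE A B ∨ lexLE B A := by
  simp only [lexLE_iff_lexKey]
  exact le_total _ _

lemma lexLE_antisymm {A B : Finset ℕ} (h : lexLE A B) (h' : lexLE B A) : A = B := by
  rw [lexLE_iff_lexKey] at *
  exact lexKey_injective (le_antisymm h' h)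

lemma exists_lexLE_least {F : Finset (Finset ℕ)} (hF : F.Nonempty) :
    ∃ X ∈ F, ∀ Z ∈ F, lexLE X Z := by
  simpa only [lexLE_iff_lexKey] using F.exists_max_image lexKey hF

/-- `A` strictly precedes `B` iff the least element where they differ belongs to `A`. -/
lemma not_lexLE_iff {A B : Finset ℕ} :
    ¬ lexLE B A ↔ ∃ y ∈ A, y ∉ B ∧ ∀ z < y, (z ∈ A ↔ z ∈ B) := by
  rw [lexLE_iff_forall]
  push Not
  constructor
  · rintro ⟨a, haA, haB, h⟩
    have hne : (A \ B).Nonempty := ⟨a, by simp [haA, haB]⟩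
    have hm := (A \ B).min'_mem hne
    have hle : (A \ B).min' hne ≤ a := Finset.min'_le _ _ (by simp [haA, haB])
    rw [Finset.mem_sdiff] at hm
    refine ⟨_, hm.1, hm.2, fun z hz => ⟨fun hzA => ?_, fun hzB => ?_⟩⟩
    · by_contra hzB
      exact absurd (Finset.min'_le (A \ B) z (by simp [hzA, hzB])) (not_le.2 hz)
    · by_contra hzA
      have := h z hzB hzA
      omega
  · rintro ⟨y, hyA, hyB, h⟩
    refine ⟨y, hyA, hyB, fun b hb hbA => ?_⟩
    rcases lt_trichotomy b y with hlt | rfl | hlt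
    · exact absurd ((h b hlt).2 hb) hbA
    · exact absurd hb hyB
    · exact hlt

lemma IsInitialSeg.subset_of_card_le {n k : ℕ} {L M : Finset (Finset ℕ)}
    (hL : IsInitialSeg n k L) (hM : IsInitialSeg n k M) (h : L.card ≤ M.card) : L ⊆ M := by
  intro A hA
  by_contra hAM
  have hML : M ⊆ L := fun B hB =>
    hL.2 A hA B (hM.1 hB) ((lexLE_total B A).resolve_right fun hAB =>
      hAM (hM.2 B hB A (hL.1 hA) hAB))
  exact hAM (Finset.eq_of_subset_of_card_le hML h ▸ hA)

lemma IsInitialSeg.exists_next {n k : ℕ} {L : Finset (Finset ℕ)} (hL : IsInitialSeg n k L)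
    (hne : L ≠ (Icc 2 n).powersetCard k) :
    ∃ X ∈ (Icc 2 n).powersetCard k, X ∉ L ∧
      ∀ Z ∈ (Icc 2 n).powersetCard k, Z ∉ L → lexLE X Z := by
  have h : ((Icc 2 n).powersetCard k \ L).Nonempty :=
    Finset.sdiff_nonempty.2 fun h => hne (hL.1.antisymm h)
  obtain ⟨X, hX, hmin⟩ := exists_lexLE_least h
  rw [Finset.mem_sdiff] at hX
  exact ⟨X, hX.1, hX.2, fun Z hZ hZL => hmin Z (Finset.mem_sdiff.2 ⟨hZ, hZL⟩)⟩

lemma exists_isInitialSeg_card {n k m : ℕ} (hm : m ≤ ((Icc 2 n).powersetCard k).card) :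
    ∃ L, IsInitialSeg n k L ∧ L.card = m := by
  induction m with
  | zero => exact ⟨∅, ⟨by simp, by simp⟩, by simp⟩
  | succ m ih =>
    obtain ⟨L, hL, rfl⟩ := ih (by omega)
    obtain ⟨X, hX, hXL, hmin⟩ := hL.exists_next (by rintro h; rw [← h] at hm; omega)
    refine ⟨insert X L, ⟨Finset.insert_subset hX hL.1, fun A hA B hB hBA => ?_⟩, by simp [hXL]⟩
    rw [Finset.mem_insert] at hA ⊢
    by_contra! hB'
    rcases hA with rfl | hA
    · exact hB'.1 (lexLE_antisymm hBA (hmin B hB hB'.2))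
    · exact hB'.2 (hL.2 A hA B hB hBA)

lemma isInitialSeg_lexFam (n k : ℕ) (X : Finset ℕ) : IsInitialSeg n k (lexFam n k X) := by
  refine ⟨Finset.filter_subset _ _, fun A hA B hB hBA => ?_⟩
  rw [lexFam, Finset.mem_filter] at *
  exact ⟨hB, lexLE_trans hBA hA.2⟩

/-- The `(k - 1)`-subsets of `[2, n]` meeting every member of `L`. -/
def crossFam (n k : ℕ) (L : Finset (Finset ℕ)) : Finset (Finset ℕ) :=
  ((Icc 2 n).powersetCard (k - 1)).filter fun A => ∀ B ∈ L, (A ∩ B).Nonempty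

/-- The `(k - 1)`-subsets of `[2, n]` disjoint from some member of `L`. -/
def missFam (n k : ℕ) (L : Finset (Finset ℕ)) : Finset (Finset ℕ) :=
  ((Icc 2 n).powersetCard (k - 1)).filter fun A => ¬ ∀ B ∈ L, (A ∩ B).Nonempty

/-- The order-reversing enumeration of `[2, n]`. -/
def revEmb (n : ℕ) : Fin (n - 1) ↪ ℕ where
  toFun i := n - i
  inj' i j h := by
    ext
    have := i.2
    have := j.2
    simp only at h
    omega

/-- The complement in `[2, n]`, transported along `revEmb`. -/
def revCompl (n : ℕ) (B : Finset ℕ) : Finset (Fin (n - 1)) :=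
  Finset.univ.filter fun i => revEmb n i ∉ B

lemma revEmb_mem (n : ℕ) (i : Fin (n - 1)) : revEmb n i ∈ Icc 2 n := by
  have := i.2
  change n - (i : ℕ) ∈ Icc 2 n
  rw [Finset.mem_Icc]
  omega

lemma map_revEmb_univ (n : ℕ) : Finset.univ.map (revEmb n) = Icc 2 n := by
  refine Finset.eq_of_subset_of_card_le (fun x hx => ?_) (by simp)
  obtain ⟨i, -, rfl⟩ := Finset.mem_map.1 hx
  exact revEmb_mem n i

lemma map_revCompl (n : ℕ) (B : Finset ℕ) : (revCompl n B).map (revEmb n) = Icc 2 n \ B := by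
  ext x
  rw [← map_revEmb_univ]
  simp only [revCompl, Finset.mem_map, Finset.mem_filter, Finset.mem_univ, true_and,
    Finset.mem_sdiff]
  constructor
  · rintro ⟨a, ha, rfl⟩
    exact ⟨⟨a, rfl⟩, ha⟩
  · rintro ⟨⟨a, rfl⟩, ha⟩
    exact ⟨a, ha, rfl⟩

lemma revCompl_map (n : ℕ) (D : Finset (Fin (n - 1))) : revCompl n (D.map (revEmb n)) = Dᶜ := by
  ext i
  simp [revCompl]

lemma card_revCompl {n : ℕ} {B : Finset ℕ} (hB : B ⊆ Icc 2 n) :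
    (revCompl n B).card = n - 1 - B.card := by
  rw [← Finset.card_map (revEmb n), map_revCompl, Finset.card_sdiff_of_subset hB]
  simp

lemma revCompl_injOn {n : ℕ} {A B : Finset ℕ} (hA : A ⊆ Icc 2 n) (hB : B ⊆ Icc 2 n)
    (h : revCompl n A = revCompl n B) : A = B := by
  have := congrArg (Finset.map (revEmb n)) h
  rw [map_revCompl, map_revCompl] at this
  rw [← Finset.sdiff_sdiff_eq_self hA, this, Finset.sdiff_sdiff_eq_self hB]

lemma lexLE_of_revCompl_lt {n : ℕ} {A B : Finset ℕ} (hB : B ⊆ Icc 2 n)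
    (h : toColex (revCompl n A) < toColex (revCompl n B)) : lexLE A B := by
  rw [Finset.Colex.toColex_lt_toColex] at h
  rw [lexLE_iff_forall]
  intro a haB haA
  have : a ∈ Icc 2 n := hB haB
  rw [← map_revEmb_univ, Finset.mem_map] at this
  obtain ⟨i, -, rfl⟩ := this
  obtain ⟨j, hj, hj', hij⟩ :=
    h.2 (show i ∈ revCompl n A by simpa [revCompl]) (by simpa [revCompl])
  refine ⟨revEmb n j, by simpa [revCompl] using hj', by simpa [revCompl] using hj, ?_⟩
  change n - (j : ℕ) ≤ n - (i : ℕ)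
  have : (i : ℕ) ≤ j := hij
  omega

open scoped FinsetFamily in
lemma missFam_eq {n k : ℕ} (hk : 1 ≤ k) (hn : 2 * k ≤ n) {L : Finset (Finset ℕ)}
    (hL : L ⊆ (Icc 2 n).powersetCard k) :
    missFam n k L = (∂^[n - 2 * k] (L.image (revCompl n))).map
      (Finset.mapEmbedding (revEmb n)).toEmbedding := by
  ext A
  simp only [missFam, Finset.mem_filter, Finset.mem_powersetCard, Finset.mem_map,
    Finset.mem_shadow_iterate_iff_exists_mem_card_add, Finset.mem_image,
    RelEmbedding.coe_toEmbedding, Finset.mapEmbedding_apply]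
  push Not
  constructor
  · rintro ⟨⟨hA, hAc⟩, B, hB, hAB⟩
    have hB' := Finset.mem_powersetCard.1 (hL hB)
    refine ⟨(revCompl n A)ᶜ, ⟨_, ⟨B, hB, rfl⟩, ?_, ?_⟩, ?_⟩
    · intro i hi
      simp only [revCompl, Finset.mem_compl, Finset.mem_filter, Finset.mem_univ, true_and,
        not_not] at hi ⊢
      exact fun hiB => Finset.notMem_empty _ (hAB ▸ Finset.mem_inter.2 ⟨hi, hiB⟩)
    · rw [Finset.card_compl, card_revCompl hA, card_revCompl hB'.1, Fintype.card_fin, hAc, hB'.2]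
      omega
    · have h := map_revCompl n (Icc 2 n \ A)
      rw [Finset.sdiff_sdiff_eq_self hA] at h
      rw [← h]
      congr 1
      ext i
      simp [revCompl]
  · rintro ⟨D, ⟨_, ⟨B, hB, rfl⟩, hDB, hc⟩, rfl⟩
    have hB' := Finset.mem_powersetCard.1 (hL hB)
    rw [card_revCompl hB'.1, hB'.2] at hc
    refine ⟨⟨fun x hx => ?_, by rw [Finset.card_map]; omega⟩, B, hB, ?_⟩
    · obtain ⟨i, -, rfl⟩ := Finset.mem_map.1 hx
      exact revEmb_mem n i
    · rw [← Finset.disjoint_iff_inter_eq_empty, Finset.disjoint_left]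
      intro x hx
      obtain ⟨i, hi, rfl⟩ := Finset.mem_map.1 hx
      simpa [revCompl] using hDB hi

lemma card_crossFam_add_card_missFam (n k : ℕ) (L : Finset (Finset ℕ)) :
    (crossFam n k L).card + (missFam n k L).card = ((Icc 2 n).powersetCard (k - 1)).card :=
  Finset.card_filter_add_card_filter_not _

/-- Hilton's form of the Kruskal–Katona theorem. -/
lemma card_crossFam_le {n k : ℕ} (hk : 1 ≤ k) (hn : 2 * k ≤ n) {L ℬ : Finset (Finset ℕ)}
    (hL : IsInitialSeg n k L) (hℬ : ℬ ⊆ (Icc 2 n).powersetCard k) (hcard : L.card ≤ ℬ.card) :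
    (crossFam n k ℬ).card ≤ (crossFam n k L).card := by
  have key : (missFam n k L).card ≤ (missFam n k ℬ).card := by
    rw [missFam_eq hk hn hL.1, missFam_eq hk hn hℬ, Finset.card_map, Finset.card_map]
    have hc : ∀ M ⊆ (Icc 2 n).powersetCard k, (M.image (revCompl n)).card = M.card :=
      fun M hM => Finset.card_image_of_injOn fun A hA B hB h =>
        revCompl_injOn (Finset.mem_powersetCard.1 (hM hA)).1
          (Finset.mem_powersetCard.1 (hM hB)).1 h
    have hs : ∀ M ⊆ (Icc 2 n).powersetCard k,
        ((M.image (revCompl n) : Finset (Finset (Fin (n - 1)))) :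
          Set (Finset (Fin (n - 1)))).Sized (n - 1 - k) := by
      intro M hM D hD
      obtain ⟨B, hB, rfl⟩ := Finset.mem_image.1 (Finset.mem_coe.1 hD)
      have hB' := Finset.mem_powersetCard.1 (hM hB)
      rw [card_revCompl hB'.1, hB'.2]
    refine Finset.iterated_kk (hs ℬ hℬ) (by rwa [hc L hL.1, hc ℬ hℬ]) ⟨hs L hL.1, ?_⟩
    rintro _ D hs' ⟨hlt, hD⟩
    obtain ⟨B, hB, rfl⟩ := Finset.mem_image.1 hs'
    have hB' := Finset.mem_powersetCard.1 (hL.1 hB)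
    have hDe : revCompl n ((Dᶜ).map (revEmb n)) = D := by rw [revCompl_map, compl_compl]
    rw [← hDe] at hlt ⊢
    refine Finset.mem_image_of_mem _ (hL.2 B hB _ (Finset.mem_powersetCard.2 ⟨?_, ?_⟩)
      (lexLE_of_revCompl_lt hB'.1 hlt))
    · rw [← map_revEmb_univ]
      exact Finset.map_subset_map.2 (Finset.subset_univ _)
    · rw [Finset.card_map, Finset.card_compl, Fintype.card_fin, hD]
      omega
  have h₁ := card_crossFam_add_card_missFam n k L
  have h₂ := card_crossFam_add_card_missFam n k ℬ
  omega

/-- Filling up the block of all `k`-sets sharing the trace of `X` on `[i]`, where `X` is the first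
set outside the initial segment `L`, does not decrease the total size. -/
lemma card_crossFam_add_card_le_fill {n k i : ℕ} (hn : 2 * k ≤ n) (hi : 1 ≤ i)
    (hin : i ≤ n) {L L' : Finset (Finset ℕ)} {X : Finset ℕ} (hX : X ∈ (Icc 2 n).powersetCard k)
    (hmin : ∀ Z ∈ (Icc 2 n).powersetCard k, Z ∉ L → lexLE X Z)
    (hXi : (Icc 1 i ∩ X).card < k) (hd : (Icc 1 i ∩ X).card ≤ (Icc 1 i \ X).card)
    (hL' : L' = L ∪ ((Icc 2 n).powersetCard k).filter fun Z => Icc 1 i ∩ Z = Icc 1 i ∩ X) :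
    (crossFam n k L).card + L.card ≤ (crossFam n k L').card + L'.card := by
  have hLL' : L ⊆ L' := hL' ▸ Finset.subset_union_left
  have hmemX := Finset.mem_powersetCard.1 hX
  have hX2 : ∀ z ∈ X, 2 ≤ z := fun z hz => (Finset.mem_Icc.1 (hmemX.1 hz)).1
  set P := Icc 2 i \ X with hP
  have hPc : (Icc 1 i \ X).card = P.card + 1 := by
    have : Icc 1 i \ X = insert 1 P := by
      ext z
      have := hX2 z
      simp only [hP, Finset.mem_insert, Finset.mem_sdiff, Finset.mem_Icc]
      constructor
      · rintro ⟨h1, h2⟩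
        by_cases hz : z = 1
        · exact Or.inl hz
        · exact Or.inr ⟨by omega, h2⟩
      · rintro (rfl | ⟨h1, h2⟩)
        · exact ⟨by omega, fun h => by have := this h; omega⟩
        · exact ⟨by omega, h2⟩
    rw [this, Finset.card_insert_of_notMem (by simp [hP])]
  have hsum : (Icc 1 i ∩ X).card + (P.card + 1) = i := by
    rw [← hPc, Finset.card_inter_add_card_sdiff]
    simp
  have htrace : ∀ B ∈ L', B ∉ L → B ∈ (Icc 2 n).powersetCard k ∧ Icc 1 i ∩ B = Icc 1 i ∩ X := by
    intro B hB hBL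
    rw [hL', Finset.mem_union, Finset.mem_filter] at hB
    exact hB.resolve_left hBL
  have hlost : ∀ A ∈ crossFam n k L \ crossFam n k L', A ⊆ Icc 2 n ∧ A.card = k - 1 ∧
      (∀ B ∈ L, (A ∩ B).Nonempty) ∧ Icc 1 i ∩ A = P := by
    intro A hA
    simp only [crossFam, Finset.mem_sdiff, Finset.mem_filter, Finset.mem_powersetCard] at hA
    obtain ⟨⟨hA, hAL⟩, hA'⟩ := hA
    refine ⟨hA.1, hA.2, hAL, ?_⟩
    have : ∃ B ∈ L', ¬ (A ∩ B).Nonempty := by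
      by_contra! h
      exact hA' ⟨hA, h⟩
    obtain ⟨B, hBL', hAB⟩ := this
    obtain ⟨hB, hBX⟩ := htrace B hBL' fun h => hAB (hAL B h)
    rw [Finset.not_nonempty_iff_eq_empty, ← Finset.disjoint_iff_inter_eq_empty,
      Finset.disjoint_left] at hAB
    have hBX' : ∀ z, 1 ≤ z → z ≤ i → (z ∈ B ↔ z ∈ X) := by
      intro z h1 h2
      have := Finset.ext_iff.1 hBX z
      simpa [h1, h2] using this
    rw [Finset.mem_powersetCard] at hB
    ext z
    simp only [hP, Finset.mem_inter, Finset.mem_sdiff, Finset.mem_Icc]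
    constructor
    · rintro ⟨⟨h1, h2⟩, hzA⟩
      exact ⟨⟨(Finset.mem_Icc.1 (hA.1 hzA)).1, h2⟩, fun h => hAB hzA ((hBX' z h1 h2).2 h)⟩
    · rintro ⟨⟨h1, h2⟩, hzX⟩
      refine ⟨⟨by omega, h2⟩, ?_⟩
      by_contra hzA
      have hzB : z ∉ B := fun h => hzX ((hBX' z (by omega) h2).1 h)
      obtain ⟨b, hb, hbi⟩ : ∃ b ∈ B, i < b := by
        by_contra! h
        have : B ⊆ Icc 1 i ∩ X := by
          rw [← hBX]
          intro b hb
          have := Finset.mem_Icc.1 (hB.1 hb)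
          have := h b hb
          simp only [Finset.mem_inter, Finset.mem_Icc]
          exact ⟨by omega, hb⟩
        have := Finset.card_le_card this
        omega
      have hzE : z ∉ B.erase b := fun h => hzB (Finset.mem_of_mem_erase h)
      have hB' : insert z (B.erase b) ∈ (Icc 2 n).powersetCard k := by
        rw [Finset.mem_powersetCard, Finset.card_insert_of_notMem hzE,
          Finset.card_erase_of_mem hb]
        refine ⟨Finset.insert_subset (Finset.mem_Icc.2 ⟨h1, by omega⟩)
          ((Finset.erase_subset _ _).trans hB.1), ?_⟩
        omega
      have hprec : ¬ lexLE X (insert z (B.erase b)) := by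
        rw [not_lexLE_iff]
        refine ⟨z, by simp, hzX, fun w hw => ?_⟩
        rw [Finset.mem_insert, Finset.mem_erase]
        by_cases hw1 : 1 ≤ w
        · rw [← hBX' w hw1 (by omega)]
          constructor
          · rintro (h | h)
            · omega
            · exact h.2
          · exact fun h => Or.inr ⟨by omega, h⟩
        · constructor
          · rintro (h | h)
            · omega
            · have := Finset.mem_Icc.1 (hB.1 h.2)
              omega
          · intro h
            have := hX2 w h
            omega
      have hB'L : insert z (B.erase b) ∈ L := by
        by_contra h
        exact hprec (hmin _ hB' h)
      obtain ⟨w, hw⟩ := hAL _ hB'L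
      rw [Finset.mem_inter, Finset.mem_insert, Finset.mem_erase] at hw
      rcases hw with ⟨hwA, rfl | hwB⟩
      · exact hzA hwA
      · exact hAB hwA hwB.2
  rcases (crossFam n k L \ crossFam n k L').eq_empty_or_nonempty with hem | ⟨A₀, hA₀⟩
  · exact Nat.add_le_add (Finset.card_le_card (Finset.sdiff_eq_empty_iff_subset.1 hem))
      (Finset.card_le_card hLL')
  have hsplit : ∀ A : Finset ℕ, A ⊆ Icc 2 n →
      (Icc 1 i ∩ A).card + (Icc (i + 1) n ∩ A).card = A.card := by
    intro A hA
    rw [← Finset.card_union_of_disjoint]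
    · congr 1
      ext z
      simp only [Finset.mem_union, Finset.mem_inter, Finset.mem_Icc]
      constructor
      · rintro (h | h) <;> exact h.2
      · intro h
        have := Finset.mem_Icc.1 (hA h)
        by_cases hz : z ≤ i
        · exact Or.inl ⟨by omega, h⟩
        · exact Or.inr ⟨by omega, h⟩
    · rw [Finset.disjoint_left]
      simp only [Finset.mem_inter, Finset.mem_Icc]
      omega
  obtain ⟨r, hr⟩ : ∃ r, P.card + r = k - 1 := by
    obtain ⟨h1, h2, -, h4⟩ := hlost A₀ hA₀
    exact ⟨_, by rw [← h4, ← h2]; exact hsplit A₀ h1⟩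
  obtain ⟨s, hs⟩ : ∃ s, (Icc 1 i ∩ X).card + s = k :=
    ⟨_, by rw [← hmemX.2]; exact hsplit X hmemX.1⟩
  obtain ⟨t, ht⟩ : ∃ t, r + s + t = n - i := ⟨n - i - r - s, by omega⟩
  have hrest : ∀ A : Finset ℕ, (Icc (i + 1) n \ A).card + (Icc (i + 1) n ∩ A).card = n - i := by
    intro A
    rw [Finset.card_sdiff_add_card_inter, Nat.card_Icc]
    omega
  have hdeg : (crossFam n k L \ crossFam n k L').card * (s + t).choose s
      ≤ (L' \ L).card * (r + t).choose r := by
    refine Finset.card_mul_le_card_mul (fun A B : Finset ℕ => Disjoint A B) ?_ ?_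
    · intro A hA
      obtain ⟨h1, h2, h3, h4⟩ := hlost A hA
      have hc : ((Icc (i + 1) n \ A).powersetCard s).card = (s + t).choose s := by
        have := hrest A
        have := hsplit A h1
        rw [Finset.card_powersetCard]
        congr 1
        rw [h4] at this
        omega
      rw [← hc]
      refine Finset.card_le_card_of_injOn (fun W => (Icc 1 i ∩ X) ∪ W) ?_ ?_
      · intro W hW
        rw [Finset.mem_coe, Finset.mem_powersetCard] at hW
        have hWi : ∀ z ∈ W, i + 1 ≤ z ∧ z ≤ n ∧ z ∉ A := by
          intro z hz
          have := hW.1 hz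
          simpa [and_assoc] using this
        have hdisj : Disjoint (Icc 1 i ∩ X) W := by
          rw [Finset.disjoint_left]
          intro z hz hzW
          have := hWi z hzW
          simp only [Finset.mem_inter, Finset.mem_Icc] at hz
          omega
        have hAd : Disjoint A (Icc 1 i ∩ X ∪ W) := by
          rw [Finset.disjoint_left]
          intro z hzA hz
          rcases Finset.mem_union.1 hz with hz | hz
          · have hzP : z ∈ P := by
              rw [← h4]
              exact Finset.mem_inter.2 ⟨(Finset.mem_inter.1 hz).1, hzA⟩
            exact (Finset.mem_sdiff.1 hzP).2 (Finset.mem_inter.1 hz).2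
          · exact (hWi z hz).2.2 hzA
        have hk' : Icc 1 i ∩ X ∪ W ∈ (Icc 2 n).powersetCard k := by
          rw [Finset.mem_powersetCard, Finset.card_union_of_disjoint hdisj, hW.2]
          refine ⟨Finset.union_subset (Finset.inter_subset_right.trans hmemX.1) ?_, hs⟩
          intro z hz
          have := hWi z hz
          rw [Finset.mem_Icc]
          omega
        rw [Finset.mem_coe, Finset.mem_bipartiteAbove, Finset.mem_sdiff, hL', Finset.mem_union,
          Finset.mem_filter]
        refine ⟨⟨Or.inr ⟨hk', ?_⟩, fun h => ?_⟩, hAd⟩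
        · ext z
          have := hWi z
          simp only [Finset.mem_inter, Finset.mem_union, Finset.mem_Icc]
          constructor
          · rintro ⟨h1, h2 | h2⟩
            · exact h2
            · have := this h2
              omega
          · exact fun h => ⟨h.1, Or.inl h⟩
        · exact Finset.not_nonempty_iff_eq_empty.2 (Finset.disjoint_iff_inter_eq_empty.1 hAd)
            (h3 _ h)
      · intro W hW W' hW' h
        rw [Finset.mem_coe, Finset.mem_powersetCard] at hW hW'
        have hback : ∀ V ⊆ Icc (i + 1) n \ A, Icc (i + 1) n ∩ (Icc 1 i ∩ X ∪ V) = V := by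
          intro V hV
          ext z
          have hz : z ∈ V → i + 1 ≤ z ∧ z ≤ n := fun h => by
            have := hV h
            simp only [Finset.mem_sdiff, Finset.mem_Icc] at this
            exact this.1
          simp only [Finset.mem_inter, Finset.mem_union, Finset.mem_Icc]
          constructor
          · rintro ⟨h1, h2 | h2⟩
            · omega
            · exact h2
          · exact fun h => ⟨hz h, Or.inr h⟩
        rw [← hback W hW.1, ← hback W' hW'.1]
        exact congrArg _ h
    · intro B hB
      rw [Finset.mem_sdiff] at hB
      obtain ⟨hBk, hBX⟩ := htrace B hB.1 hB.2
      rw [Finset.mem_powersetCard] at hBk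
      have hc : ((Icc (i + 1) n \ B).powersetCard r).card = (r + t).choose r := by
        have := hrest B
        have := hsplit B hBk.1
        rw [Finset.card_powersetCard]
        congr 1
        rw [hBX] at this
        omega
      rw [← hc]
      refine Finset.card_le_card_of_injOn (fun A => Icc (i + 1) n ∩ A) ?_ ?_
      · intro A hA
        rw [Finset.mem_coe, Finset.mem_bipartiteBelow] at hA
        obtain ⟨h1, h2, h3, h4⟩ := hlost A hA.1
        rw [Finset.mem_coe, Finset.mem_powersetCard]
        constructor
        · intro z hz
          rw [Finset.mem_inter] at hz
          exact Finset.mem_sdiff.2 ⟨hz.1, Finset.disjoint_left.1 hA.2 hz.2⟩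
        · have := hsplit A h1
          rw [h4] at this
          change (Icc (i + 1) n ∩ A).card = r
          omega
      · intro A hA A' hA' h
        rw [Finset.mem_coe, Finset.mem_bipartiteBelow] at hA hA'
        obtain ⟨h1, h2, h3, h4⟩ := hlost A hA.1
        obtain ⟨h1', h2', h3', h4'⟩ := hlost A' hA'.1
        have hback : ∀ V ⊆ Icc 2 n, V = (Icc 1 i ∩ V) ∪ (Icc (i + 1) n ∩ V) := by
          intro V hV
          rw [← Finset.union_inter_distrib_right]
          refine (Finset.inter_eq_right.2 fun z hz => ?_).symm
          have := Finset.mem_Icc.1 (hV hz)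
          simp only [Finset.mem_union, Finset.mem_Icc]
          omega
        rw [hback A h1, hback A' h1', h4, h4']
        exact congrArg _ h
  have hchoose : (r + t).choose r ≤ (s + t).choose s := by
    rw [Nat.choose_symm_add, Nat.choose_symm_add]
    exact Nat.choose_le_choose _ (by omega)
  have hpos : 0 < (s + t).choose s := Nat.choose_pos (by omega)
  have hmain : (crossFam n k L \ crossFam n k L').card ≤ (L' \ L).card :=
    Nat.le_of_mul_le_mul_right (hdeg.trans (Nat.mul_le_mul_left _ hchoose)) hpos
  have e1 := Finset.card_sdiff_add_card_eq_card hLL'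
  have e2 := Finset.le_card_sdiff (crossFam n k L') (crossFam n k L)
  omega

/-- `T.max` is `j`, in the form in which `ResistantPair` states it. -/
lemma max_eq_natCast_iff {T : Finset ℕ} {j : ℕ} :
    T.max = (j : WithTop ℕ) ↔ j ∈ T ∧ ∀ x ∈ T, x ≤ j := by
  change T.max = ((j : ℕ) : WithBot ℕ) ↔ _
  constructor
  · exact fun h => ⟨Finset.mem_of_max h, fun x hx => Finset.le_max_of_eq hx h⟩
  · rintro ⟨hj, h⟩
    exact le_antisymm (Finset.max_le fun x hx => WithBot.coe_le_coe.2 (h x hx)) (Finset.le_max hj)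

lemma ResistantPair.exists_max {n k : ℕ} {S T : Finset ℕ} (h : ResistantPair n k S T)
    (hk : 3 ≤ k) (hn : 4 ≤ n) :
    T ⊆ Icc 2 n ∧ T.card ≤ k ∧ ∃ j, S ∩ T = {j} ∧ S ∪ T = Icc 1 j := by
  rcases h with ⟨rfl, rfl⟩ | ⟨-, -, hT, j, -, h1, h2, -, h3, -⟩
  · refine ⟨?_, by simpa using hk, 4, by decide, by decide⟩
    intro x hx
    simp only [Finset.mem_insert, Finset.mem_singleton] at hx
    rw [Finset.mem_Icc]
    omega
  · exact ⟨hT, h3, j, h1, h2⟩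

lemma ResistantPair.card_sdiff_lt {n k i y : ℕ} {S T : Finset ℕ} (h : ResistantPair n k S T)
    (hi : 4 ≤ i) (hy : y ∈ T) (hiy : i < y) :
    (Icc 1 i \ T).card < (Icc 1 i ∩ T).card := by
  rcases h with ⟨rfl, rfl⟩ | ⟨-, -, -, j, -, h1, h2, -, -, h⟩
  · simp only [Finset.mem_insert, Finset.mem_singleton] at hy
    omega
  · have hyj : y ≤ j := (Finset.mem_Icc.1 (h2 ▸ Finset.mem_union_right S hy)).2
    have key : ∀ z ∈ Icc 1 i, (z ∈ S ↔ z ∉ T) := by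
      intro z hz
      rw [Finset.mem_Icc] at hz
      have hu : z ∈ S ∪ T := by rw [h2, Finset.mem_Icc]; omega
      have hint : z ∉ S ∩ T := by rw [h1, Finset.mem_singleton]; omega
      rw [Finset.mem_union] at hu
      rw [Finset.mem_inter] at hint
      tauto
    have e1 : Icc 1 i ∩ S = Icc 1 i \ T := by
      ext z
      rw [Finset.mem_inter, Finset.mem_sdiff]
      exact and_congr_right (key z)
    have e2 : Icc 1 i \ S = Icc 1 i ∩ T := by
      ext z
      rw [Finset.mem_inter, Finset.mem_sdiff]
      exact and_congr_right fun hz => by rw [key z hz, not_not]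
    rw [← e1, ← e2]
    exact h i hi (by omega)

/-- Every `(k - 1)`-set meeting all members of `lexFam n k T` lies in `lexFam n (k - 1) S`. -/
lemma ResistantPair.crossFam_lexFam_subset {n k : ℕ} {S T : Finset ℕ}
    (h : ResistantPair n k S T) (hk : 3 ≤ k) (hn : 2 * k < n) :
    crossFam n k (lexFam n k T) ⊆ lexFam n (k - 1) S := by
  obtain ⟨hT, hTk, j, hST, hSTu⟩ := h.exists_max hk (by omega)
  have hjT : j ∈ T :=
    (Finset.mem_inter.1 (hST ▸ Finset.mem_singleton_self j : j ∈ S ∩ T)).2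
  have hle : ∀ x, x ∈ S ∨ x ∈ T → x ≤ j := fun x hx =>
    (Finset.mem_Icc.1 (hSTu ▸ Finset.mem_union.2 hx)).2
  have hcap : ∀ x, x ∈ S → x ∈ T → x = j := fun x hS hT' =>
    Finset.mem_singleton.1 (hST ▸ Finset.mem_inter.2 ⟨hS, hT'⟩)
  intro A hA
  rw [crossFam, Finset.mem_filter] at hA
  rw [lexFam, Finset.mem_filter]
  refine ⟨hA.1, ?_⟩
  by_contra hlex
  rw [not_lexLE_iff] at hlex
  obtain ⟨y, hyS, hyA, hagree⟩ := hlex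
  rw [Finset.mem_inter] at hyS
  have hA1 := Finset.mem_powersetCard.1 hA.1
  have hWA : insert y (T.filter (· < y)) ⊆ Icc 2 n \ A := by
    intro z hz
    rw [Finset.mem_insert, Finset.mem_filter] at hz
    rw [Finset.mem_sdiff]
    rcases hz with rfl | ⟨hzT, hzy⟩
    · exact ⟨hyS.2, hyA⟩
    · refine ⟨hT hzT, fun hzA => ?_⟩
      have h1 := hcap z (Finset.mem_inter.1 ((hagree z hzy).2 hzA)).1 hzT
      have h2 := hle y (Or.inl hyS.1)
      omega
  have hWk : (insert y (T.filter (· < y))).card ≤ k := by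
    have : T.filter (· < y) ⊆ T.erase j := by
      intro z hz
      rw [Finset.mem_filter] at hz
      have h2 := hle y (Or.inl hyS.1)
      exact Finset.mem_erase.2 ⟨by omega, hz.1⟩
    have := Finset.card_le_card this
    rw [Finset.card_erase_of_mem hjT] at this
    have := Finset.card_insert_le y (T.filter (· < y))
    have := Finset.card_pos.2 ⟨j, hjT⟩
    omega
  have hbig : k ≤ (Icc 2 n \ A).card := by
    rw [Finset.card_sdiff_of_subset hA1.1, hA1.2, Nat.card_Icc]
    omega
  obtain ⟨B, hWB, hBA, hBk⟩ := Finset.exists_subsuperset_card_eq hWA hWk hbig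
  have hB : B ∈ lexFam n k T := by
    rw [lexFam, Finset.mem_filter, Finset.mem_powersetCard, Finset.inter_eq_left.2 hT,
      lexLE_iff_forall]
    refine ⟨⟨hBA.trans Finset.sdiff_subset, hBk⟩, fun a haT haB => ?_⟩
    have hya : y < a := by
      by_contra hlt
      refine haB (hWB ?_)
      rw [Finset.mem_insert, Finset.mem_filter]
      by_cases hay : a = y
      · exact Or.inl hay
      · exact Or.inr ⟨haT, by omega⟩
    refine ⟨y, hWB (Finset.mem_insert_self _ _), fun hyT => ?_, hya.le⟩
    have := hcap y hyS.1 hyT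
    have := hle a (Or.inr haT)
    omega
  obtain ⟨z, hz⟩ := hA.2 B hB
  rw [Finset.mem_inter] at hz
  exact (Finset.mem_sdiff.1 (hBA hz.2)).2 hz.1

/-- If `X'` strictly precedes `X`, then either the trace of `X` on some `[i]` is light, or `X'`
contains the larger set of a resistant pair which strictly precedes `X`. -/
lemma exists_light_or_resistant {n k : ℕ} (hk : 3 ≤ k) (hn : 2 * k < n) {X X' : Finset ℕ}
    (hX : X ∈ (Icc 2 n).powersetCard k) (hX' : X' ∈ (Icc 2 n).powersetCard k)
    (hlt : ¬ lexLE X X') :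
    (∃ i, 4 ≤ i ∧ i ≤ n ∧ (Icc 1 i ∩ X).card < k ∧ (Icc 1 i ∩ X).card ≤ (Icc 1 i \ X).card) ∨
      ∃ S W, ResistantPair n k S W ∧ W ⊆ X' ∧ ¬ lexLE X W := by
  by_cases hlight : ∃ i, 4 ≤ i ∧ i ≤ n ∧ (Icc 1 i ∩ X).card < k ∧
      (Icc 1 i ∩ X).card ≤ (Icc 1 i \ X).card
  · exact Or.inl hlight
  right
  push Not at hlight
  rw [not_lexLE_iff] at hlt
  obtain ⟨y, hyX', hyX, hagree⟩ := hlt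
  rw [Finset.mem_powersetCard] at hX hX'
  have h1X : 1 ∉ X := fun h => by simpa using hX.1 h
  have hy := Finset.mem_Icc.1 (hX'.1 hyX')
  obtain ⟨x, hxX, hyx⟩ : ∃ x ∈ X, y < x := by
    by_contra! h
    have : X ⊆ X'.erase y := by
      intro z hz
      have hzy : z ≠ y := fun h' => hyX (h' ▸ hz)
      have := h z hz
      exact Finset.mem_erase.2 ⟨hzy, (hagree z (by omega)).2 hz⟩
    have := Finset.card_le_card this
    rw [Finset.card_erase_of_mem hyX'] at this
    omega
  have hsmall : ∀ i ≤ y, (Icc 1 i ∩ X).card < k := by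
    intro i hi
    rw [← hX.2]
    refine Finset.card_lt_card (Finset.ssubset_iff_of_subset Finset.inter_subset_right |>.2
      ⟨x, hxX, ?_⟩)
    simp only [Finset.mem_inter, Finset.mem_Icc]
    omega
  have hy5 : 5 ≤ y := by
    by_contra hlt
    have hsub : Icc 1 4 ∩ X ⊆ ((Icc 1 4).erase 1).erase y := by
      intro z hz
      rw [Finset.mem_inter] at hz
      refine Finset.mem_erase.2 ⟨fun h => hyX (h ▸ hz.2), Finset.mem_erase.2 ⟨?_, hz.1⟩⟩
      rintro rfl
      exact h1X hz.2
    have hc := Finset.card_le_card hsub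
    rw [Finset.card_erase_of_mem (by simp only [Finset.mem_erase, Finset.mem_Icc]; omega),
      Finset.card_erase_of_mem (by simp), Nat.card_Icc] at hc
    have hsum := Finset.card_inter_add_card_sdiff (Icc 1 4) X
    rw [Nat.card_Icc] at hsum
    have := hlight 4 le_rfl (by omega) (by omega)
    omega
  have hyW : y ∉ Icc 1 y ∩ X := fun h => hyX (Finset.mem_inter.1 h).2
  have hyk := hsmall y le_rfl
  have hS : ∀ i ≤ y, Icc 1 i ∩ (Icc 1 y \ X) = Icc 1 i \ X := by
    intro i hi
    rw [← Finset.inter_sdiff_assoc, Finset.inter_eq_left.2 (Finset.Icc_subset_Icc_right hi)]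
  have hS' : ∀ i ≤ y, Icc 1 i \ (Icc 1 y \ X) = Icc 1 i ∩ X := by
    intro i hi
    ext z
    simp only [Finset.mem_sdiff, Finset.mem_inter, Finset.mem_Icc]
    constructor
    · exact fun h => ⟨h.1, by_contra fun hz => h.2 ⟨⟨h.1.1, by omega⟩, hz⟩⟩
    · exact fun h => ⟨h.1, fun h' => h'.2 h.2⟩
  refine ⟨Icc 1 y \ X, insert y (Icc 1 y ∩ X), Or.inr ⟨?_, ?_, ?_, y, ?_, ?_, ?_, ?_, ?_, ?_⟩,
    ?_, ?_⟩
  · rw [Finset.mem_sdiff, Finset.mem_Icc]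
    exact ⟨by omega, h1X⟩
  · exact Finset.sdiff_subset.trans (Finset.Icc_subset_Icc_right hy.2)
  · exact Finset.insert_subset (hX'.1 hyX') (Finset.inter_subset_right.trans hX.1)
  · rw [max_eq_natCast_iff]
    refine ⟨Finset.mem_insert_self _ _, fun z hz => ?_⟩
    simp only [Finset.mem_insert, Finset.mem_inter, Finset.mem_Icc] at hz
    omega
  · ext z
    simp only [Finset.mem_insert, Finset.mem_inter, Finset.mem_sdiff, Finset.mem_Icc,
      Finset.mem_singleton]
    constructor
    · rintro ⟨h1, h2 | h2⟩
      · exact h2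
      · exact absurd h2.2 h1.2
    · rintro rfl
      exact ⟨⟨by omega, hyX⟩, Or.inl rfl⟩
  · ext z
    simp only [Finset.mem_insert, Finset.mem_inter, Finset.mem_sdiff, Finset.mem_Icc,
      Finset.mem_union]
    constructor
    · rintro (h | h | h)
      · exact h.1
      · omega
      · exact h.1
    · intro h
      by_cases hz : z ∈ X
      · exact Or.inr (Or.inr ⟨h, hz⟩)
      · exact Or.inl ⟨h, hz⟩
  · have := hlight y (by omega) hy.2 hyk
    omega
  · rw [Finset.card_insert_of_notMem hyW]
    omega
  · intro i hi hiy
    rw [hS i hiy, hS' i hiy]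
    exact hlight i hi (by omega) (hsmall i hiy)
  · refine Finset.insert_subset hyX' fun z hz => ?_
    rw [Finset.mem_inter, Finset.mem_Icc] at hz
    have hzy : z ≠ y := fun h' => hyX (h' ▸ hz.2)
    exact (hagree z (by omega)).2 hz.2
  · rw [not_lexLE_iff]
    refine ⟨y, Finset.mem_insert_self _ _, hyX, fun z hz => ?_⟩
    simp only [Finset.mem_insert, Finset.mem_inter, Finset.mem_Icc]
    constructor
    · rintro (h | h)
      · omega
      · exact h.2
    · intro h
      have := Finset.mem_Icc.1 (hX.1 h)
      exact Or.inr ⟨by omega, h⟩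

lemma Icc_inter_eq_iff {i : ℕ} {A B : Finset ℕ} :
    Icc 1 i ∩ A = Icc 1 i ∩ B ↔ ∀ z, 1 ≤ z → z ≤ i → (z ∈ A ↔ z ∈ B) := by
  simp only [Finset.ext_iff, Finset.mem_inter, Finset.mem_Icc, and_congr_right_iff, and_imp]

/-- Sets squeezed between two sets with the same trace on `[i]` share that trace. -/
lemma Icc_inter_eq_of_lexLE {n i : ℕ} {X B A : Finset ℕ} (hX : X ⊆ Icc 2 n)
    (hA : A ⊆ Icc 2 n) (hXB : lexLE X B) (hBA : lexLE B A)
    (h : Icc 1 i ∩ A = Icc 1 i ∩ X) : Icc 1 i ∩ B = Icc 1 i ∩ X := by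
  by_cases hBX : lexLE B X
  · rw [lexLE_antisymm hBX hXB]
  rw [Icc_inter_eq_iff] at h ⊢
  rw [not_lexLE_iff] at hBX
  obtain ⟨y, hyX, hyB, hagree⟩ := hBX
  have hy := Finset.mem_Icc.1 (hX hyX)
  by_cases hyi : y ≤ i
  · refine absurd hBA (not_lexLE_iff.2 ⟨y, (h y (by omega) hyi).2 hyX, hyB, fun z hz => ?_⟩)
    rw [← hagree z hz]
    by_cases hz1 : 1 ≤ z
    · exact h z hz1 (by omega)
    · obtain rfl : z = 0 := by omega
      have h0 : ∀ C ⊆ Icc 2 n, 0 ∉ C := fun C hC h => by simpa using hC h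
      exact iff_of_false (h0 A hA) (h0 X hX)
  · exact fun z _ hz => (hagree z (by omega)).symm

lemma card_crossFam_add_card_le_lexFam {n k : ℕ} (hk : 3 ≤ k) (hn : 2 * k < n)
    {S T : Finset ℕ} (hres : ResistantPair n k S T) {X' : Finset ℕ}
    (hprev : ∀ S' W, ResistantPair n k S' W → lexLT W T → ¬ lexLE X' W)
    {L : Finset (Finset ℕ)} (hL : IsInitialSeg n k L) (hLT : L ⊆ lexFam n k T) (hX' : X' ∈ L) :
    (crossFam n k L).card + L.card ≤
      (crossFam n k (lexFam n k T)).card + (lexFam n k T).card := by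
  have hT : T ⊆ Icc 2 n := (hres.exists_max hk (by omega)).1
  have hmemT : ∀ A, A ∈ lexFam n k T ↔ A ∈ (Icc 2 n).powersetCard k ∧ lexLE A T := by
    intro A
    rw [lexFam, Finset.mem_filter, Finset.inter_eq_left.2 hT]
  induction hd : (lexFam n k T).card - L.card using Nat.strong_induction_on generalizing L with
  | _ d ih =>
  by_cases hEq : L = lexFam n k T
  · rw [← hEq]
  obtain ⟨Z, hZT, hZL⟩ := Finset.exists_of_ssubset (hLT.ssubset_of_ne hEq)
  obtain ⟨X, hX, hXL, hmin⟩ := hL.exists_next fun h =>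
    hZL (h ▸ (isInitialSeg_lexFam n k T).1 hZT)
  have hXT : lexLE X T :=
    lexLE_trans (hmin Z ((hmemT Z).1 hZT).1 hZL) ((hmemT Z).1 hZT).2
  have hX'X : ¬ lexLE X X' := fun h => hXL (hL.2 X' hX' X hX h)
  rcases exists_light_or_resistant hk hn hX (hL.1 hX') hX'X with
    ⟨i, hi4, hin, hik, hlight⟩ | ⟨S', W, hW, hWX', hXW⟩
  swap
  · refine absurd (Or.inl hWX') (hprev S' W hW ⟨?_, ?_⟩)
    · exact lexLE_trans ((lexLE_total W X).resolve_right hXW) hXT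
    · rintro rfl
      exact hXW hXT
  have hXi := Finset.mem_powersetCard.1 hX
  set L' := L ∪ ((Icc 2 n).powersetCard k).filter fun Z => Icc 1 i ∩ Z = Icc 1 i ∩ X with hL'
  have hXL' : X ∈ L' := Finset.mem_union_right _ (Finset.mem_filter.2 ⟨hX, rfl⟩)
  have hLL' : L ⊂ L' := (Finset.ssubset_iff_of_subset Finset.subset_union_left).2 ⟨X, hXL', hXL⟩
  have hinit : IsInitialSeg n k L' := by
    refine ⟨Finset.union_subset hL.1 (Finset.filter_subset _ _), fun A hA B hB hBA => ?_⟩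
    by_cases hBL : B ∈ L
    · exact Finset.mem_union_left _ hBL
    have hA' := (Finset.mem_union.1 hA).resolve_left fun h => hBL (hL.2 A h B hB hBA)
    rw [Finset.mem_filter, Finset.mem_powersetCard] at hA'
    exact Finset.mem_union_right _ (Finset.mem_filter.2
      ⟨hB, Icc_inter_eq_of_lexLE hXi.1 hA'.1.1 (hmin B hB hBL) hBA hA'.2⟩)
  have hsub : L' ⊆ lexFam n k T := by
    refine Finset.union_subset hLT fun A hA => ?_
    rw [Finset.mem_filter] at hA
    refine (hmemT A).2 ⟨hA.1, ?_⟩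
    by_contra hAT
    obtain ⟨y, hyT, hyA, hagree⟩ := not_lexLE_iff.1 hAT
    have htr := Icc_inter_eq_iff.1 hA.2
    by_cases hyi : y ≤ i
    · have hy := Finset.mem_Icc.1 (hT hyT)
      refine not_lexLE_iff.2 ⟨y, hyT, fun h => hyA ((htr y (by omega) hyi).2 h), fun z hz => ?_⟩ hXT
      rw [hagree z hz]
      by_cases hz1 : 1 ≤ z
      · exact htr z hz1 (by omega)
      · obtain rfl : z = 0 := by omega
        have h0 : ∀ C ⊆ Icc 2 n, 0 ∉ C := fun C hC h => by simpa using hC h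
        exact iff_of_false (h0 A (Finset.mem_powersetCard.1 hA.1).1) (h0 X hXi.1)
    · have htrT : ∀ z, 1 ≤ z → z ≤ i → (z ∈ T ↔ z ∈ X) := fun z h1 h2 =>
        (hagree z (by omega)).trans (htr z h1 h2)
      have hlt := hres.card_sdiff_lt hi4 hyT (by omega)
      rw [← Finset.sdiff_inter_self_left, Icc_inter_eq_iff.2 htrT,
        Finset.sdiff_inter_self_left] at hlt
      omega
  have hc := Finset.card_lt_card hLL'
  have hc' := Finset.card_le_card hsub
  exact (card_crossFam_add_card_le_fill (by omega) (by omega) hin hX hmin hik hlight hL').trans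
    (ih _ (by omega) hinit hsub (hLL'.subset hX') rfl)

lemma card_add_card_le_of_crossIntersecting {n k : ℕ} (hk : 3 ≤ k) (hn : 2 * k < n)
    {Sl Tl : Finset ℕ} (hres : ResistantPair n k Sl Tl) {γprev : ℕ}
    (hprev : (γprev = 0 ∧ ∀ S' T', ResistantPair n k S' T' → ¬ lexLT T' Tl) ∨
      (∃ Sp Tp, ResistantPair n k Sp Tp ∧ lexLT Tp Tl ∧
        (∀ S'' T'', ResistantPair n k S'' T'' → lexLT T'' Tl → lexLE T'' Tp) ∧
        γprev = (lexFam n k Tp).card))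
    {𝒜 ℬ : Finset (Finset ℕ)} (h𝒜 : 𝒜 ⊆ (Icc 2 n).powersetCard (k - 1))
    (hℬ : ℬ ⊆ (Icc 2 n).powersetCard k) (hcross : CrossIntersecting 𝒜 ℬ)
    (hlow : γprev < ℬ.card) (hup : ℬ.card ≤ (lexFam n k Tl).card) :
    𝒜.card + ℬ.card ≤ (lexFam n (k - 1) Sl).card + (lexFam n k Tl).card := by
  obtain ⟨L, hL, hLc⟩ := exists_isInitialSeg_card (Finset.card_le_card hℬ)
  have hLT : L ⊆ lexFam n k Tl := hL.subset_of_card_le (isInitialSeg_lexFam n k Tl) (by omega)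
  obtain ⟨X', hX', hX'prev⟩ : ∃ X' ∈ L, ∀ S' W, ResistantPair n k S' W → lexLT W Tl →
      ¬ lexLE X' W := by
    rcases hprev with ⟨-, hno⟩ | ⟨Sp, Tp, hp, -, hmax, rfl⟩
    · obtain ⟨X', hX'⟩ := Finset.card_pos.1 (show 0 < L.card by omega)
      exact ⟨X', hX', fun S' W hW hlt => absurd hlt (hno S' W hW)⟩
    · have hns : ¬ L ⊆ lexFam n k Tp := fun h => by
        have := Finset.card_le_card h
        omega
      obtain ⟨X', hX', hX'p⟩ := Finset.not_subset.1 hns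
      refine ⟨X', hX', fun S' W hW hlt hle => hX'p ?_⟩
      rw [lexFam, Finset.mem_filter, Finset.inter_eq_left.2 (hp.exists_max hk (by omega)).1]
      exact ⟨hL.1 hX', lexLE_trans hle (hmax S' W hW hlt)⟩
  have h1 : 𝒜.card ≤ (crossFam n k ℬ).card := Finset.card_le_card fun A hA =>
    Finset.mem_filter.2 ⟨h𝒜 hA, fun B hB => hcross A hA B hB⟩
  have h2 := card_crossFam_le (by omega) (by omega) hL hℬ hLc.le
  have h3 := card_crossFam_add_card_le_lexFam hk hn hres hX'prev hL hLT hX'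
  have h4 := Finset.card_le_card (hres.crossFam_lexFam_subset hk hn)
  omega

/-- An intersecting family splits, after moving an element of maximal degree to `1`, into a
cross-intersecting pair whose larger-uniformity part is counted by the diversity. -/
lemma IntersectingFam.exists_crossIntersecting {n k : ℕ} (hn : 1 ≤ n) {F : Finset (Finset ℕ)}
    (hF : F ⊆ (Icc 1 n).powersetCard k) (hint : IntersectingFam F) :
    ∃ 𝒜 ℬ : Finset (Finset ℕ), 𝒜 ⊆ (Icc 2 n).powersetCard (k - 1) ∧
      ℬ ⊆ (Icc 2 n).powersetCard k ∧ CrossIntersecting 𝒜 ℬ ∧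
      ℬ.card = diversity n F ∧ 𝒜.card + ℬ.card = F.card := by
  obtain ⟨a, ha, hmax⟩ := Finset.exists_mem_eq_sup (Icc 1 n) ⟨1, by simpa using hn⟩ (famDeg F)
  rw [Finset.mem_Icc] at ha
  set σ : Equiv.Perm ℕ := Equiv.swap 1 a
  have hσa : σ a = 1 := Equiv.swap_apply_right 1 a
  have hσ : ∀ x, 1 ≤ x → x ≤ n → 1 ≤ σ x ∧ σ x ≤ n := by
    intro x h1 h2
    simp only [σ, Equiv.swap_apply_def]
    split_ifs <;> omega
  have hσ1 : ∀ x, σ x = 1 ↔ x = a := fun x => by rw [← hσa, σ.apply_eq_iff_eq]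
  have hmem1 : ∀ A : Finset ℕ, 1 ∈ A.map σ.toEmbedding ↔ a ∈ A := by
    intro A
    simp only [Finset.mem_map, Equiv.coe_toEmbedding, hσ1]
    simp
  have hinto : ∀ A ∈ F, ∀ x ∈ A.map σ.toEmbedding, x ≠ 1 → x ∈ Icc 2 n := by
    intro A hA x hx hx1
    obtain ⟨w, hw, rfl⟩ := Finset.mem_map.1 hx
    have h1 := Finset.mem_Icc.1 ((Finset.mem_powersetCard.1 (hF hA)).1 hw)
    have h2 := hσ w h1.1 h1.2
    rw [Equiv.coe_toEmbedding] at hx1 ⊢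
    rw [Finset.mem_Icc]
    omega
  have hAc : ((F.filter fun A => a ∈ A).image fun A => (A.map σ.toEmbedding).erase 1).card
      = famDeg F a := by
    refine Finset.card_image_of_injOn fun A hA B hB h => ?_
    rw [Finset.mem_coe, Finset.mem_filter] at hA hB
    have h' : insert 1 ((A.map σ.toEmbedding).erase 1) =
        insert 1 ((B.map σ.toEmbedding).erase 1) := congrArg (insert 1) h
    rw [Finset.insert_erase ((hmem1 A).2 hA.2), Finset.insert_erase ((hmem1 B).2 hB.2)] at h'
    exact Finset.map_injective _ h'
  have hBc : ((F.filter fun A => a ∉ A).image fun A => A.map σ.toEmbedding).card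
      = (F.filter fun A => a ∉ A).card :=
    Finset.card_image_of_injective _ (Finset.map_injective _)
  have hsum : famDeg F a + (F.filter fun A => a ∉ A).card = F.card :=
    Finset.card_filter_add_card_filter_not _
  refine ⟨(F.filter fun A => a ∈ A).image fun A => (A.map σ.toEmbedding).erase 1,
    (F.filter fun A => a ∉ A).image fun A => A.map σ.toEmbedding, ?_, ?_, ?_, ?_, ?_⟩
  · intro A' hA'
    obtain ⟨A, hA, rfl⟩ := Finset.mem_image.1 hA'
    rw [Finset.mem_filter] at hA
    rw [Finset.mem_powersetCard, Finset.card_erase_of_mem ((hmem1 A).2 hA.2), Finset.card_map,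
      (Finset.mem_powersetCard.1 (hF hA.1)).2]
    refine ⟨fun x hx => ?_, rfl⟩
    rw [Finset.mem_erase] at hx
    exact hinto A hA.1 x hx.2 hx.1
  · intro B' hB'
    obtain ⟨B, hB, rfl⟩ := Finset.mem_image.1 hB'
    rw [Finset.mem_filter] at hB
    rw [Finset.mem_powersetCard, Finset.card_map, (Finset.mem_powersetCard.1 (hF hB.1)).2]
    refine ⟨fun x hx => hinto B hB.1 x hx ?_, rfl⟩
    rintro rfl
    exact hB.2 ((hmem1 B).1 hx)
  · intro A' hA' B' hB'
    obtain ⟨A, hA, rfl⟩ := Finset.mem_image.1 hA'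
    obtain ⟨B, hB, rfl⟩ := Finset.mem_image.1 hB'
    rw [Finset.mem_filter] at hA hB
    obtain ⟨z, hz⟩ := hint A hA.1 B hB.1
    rw [Finset.mem_inter] at hz
    refine ⟨σ z, Finset.mem_inter.2 ⟨Finset.mem_erase.2 ⟨fun h => ?_, ?_⟩, ?_⟩⟩
    · exact hB.2 ((hσ1 z).1 h ▸ hz.2)
    · exact Finset.mem_map_of_mem σ.toEmbedding hz.1
    · exact Finset.mem_map_of_mem σ.toEmbedding hz.2
  · rw [hBc, diversity, maxDeg, hmax]
    omega
  · rw [hAc, hBc, hsum]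

/-- the "conceptual" characteristic-set version (Theorem `thmfull2`). -/
theorem statement1 (n k : ℕ) (hk : 3 ≤ k) (hn : 2 * k < n)
    (Sl Tl : Finset ℕ) (hres : ResistantPair n k Sl Tl) (γprev : ℕ)
    (hprev : (γprev = 0 ∧ ∀ S' T', ResistantPair n k S' T' → ¬ lexLT T' Tl) ∨
      (∃ Sp Tp, ResistantPair n k Sp Tp ∧ lexLT Tp Tl ∧
        (∀ S'' T'', ResistantPair n k S'' T'' → lexLT T'' Tl → lexLE T'' Tp) ∧
        γprev = (lexFam n k Tp).card)) :
    (∀ 𝒜 ℬ : Finset (Finset ℕ),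
      𝒜 ⊆ (Finset.Icc 2 n).powersetCard (k - 1) →
      ℬ ⊆ (Finset.Icc 2 n).powersetCard k →
      CrossIntersecting 𝒜 ℬ → γprev < ℬ.card → ℬ.card ≤ (lexFam n k Tl).card →
      𝒜.card + ℬ.card ≤ (lexFam n (k - 1) Sl).card + (lexFam n k Tl).card) ∧
    (∀ F : Finset (Finset ℕ), F ⊆ (Finset.Icc 1 n).powersetCard k →
      IntersectingFam F →
      γprev < diversity n F → diversity n F ≤ (lexFam n k Tl).card →
      F.card ≤ (lexFam n (k - 1) Sl).card + (lexFam n k Tl).card) := by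
  have hpair := fun 𝒜 ℬ : Finset (Finset ℕ) =>
    card_add_card_le_of_crossIntersecting (𝒜 := 𝒜) (ℬ := ℬ) hk hn hres hprev
  refine ⟨fun 𝒜 ℬ => hpair 𝒜 ℬ, fun F hF hint hlow hup => ?_⟩
  obtain ⟨𝒜, ℬ, h𝒜, hℬ, hcross, hγ, hsum⟩ := hint.exists_crossIntersecting (by omega) hF
  rw [← hsum]
  rw [← hγ] at hlow hup
  exact hpair 𝒜 ℬ h𝒜 hℬ hcross hlow hup
end

section
/- Let n > 2k and k ≥ 4. Then every intersecting family F of k-element subsets of [n] with γ(F) ≥ 2 satisfies |F| ≤ C(n−1,k−1) − C(n−k−1,k−1) − C(n−k−2,k−2) + 2. Moreover, if k ≥ 5, equality holds only for families isomorphic to J_2. -/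
open Finset

open scoped FinsetFamily

section Counting

variable {V A B C : Finset ℕ} {𝒢 : Finset (Finset ℕ)} {a c r s : ℕ}

lemma card_filter_disjoint (hA : A ⊆ V) (hAa : #A = a) (hV : #V = a + c) :
    #{T ∈ V.powersetCard r | Disjoint T A} = c.choose r := by
  have h : {T ∈ V.powersetCard r | Disjoint T A} = (V \ A).powersetCard r := by
    ext T
    simp only [mem_filter, mem_powersetCard, subset_sdiff]
    tauto
  rw [h, card_powersetCard, card_sdiff_of_subset hA, hV, hAa, Nat.add_sub_cancel_left]

lemma card_filter_disjoint_mem {e : ℕ} (hA : A ⊆ V) (hAa : #A = a) (hV : #V = a + (c + 1))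
    (he : e ∈ V) (heA : e ∉ A) :
    #{T ∈ V.powersetCard (s + 1) | Disjoint T A ∧ e ∈ T} = c.choose s := by
  have h : {T ∈ V.powersetCard (s + 1) | Disjoint T A ∧ e ∈ T}
      = (((V \ A).erase e).powersetCard s).image (insert e) := by
    ext T
    simp only [mem_filter, mem_powersetCard, mem_image]
    constructor
    · rintro ⟨⟨hTV, hT⟩, hd, heT⟩
      refine ⟨T.erase e, ⟨erase_subset_erase e (subset_sdiff.2 ⟨hTV, hd⟩), ?_⟩, insert_erase heT⟩
      rw [card_erase_of_mem heT, hT, Nat.add_sub_cancel]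
    · rintro ⟨T, ⟨hT, hTs⟩, rfl⟩
      have heT : e ∉ T := fun h => (mem_erase.1 (hT h)).1 rfl
      have hT' : T ⊆ V \ A := hT.trans (erase_subset _ _)
      have := subset_sdiff.1 hT'
      refine ⟨⟨insert_subset he this.1, by rw [card_insert_of_notMem heT, hTs]⟩, ?_,
        mem_insert_self _ _⟩
      exact disjoint_insert_left.2 ⟨heA, this.2⟩
  rw [h, card_image_of_injOn, card_powersetCard, card_erase_of_mem (mem_sdiff.2 ⟨he, heA⟩),
    card_sdiff_of_subset hA, hV, hAa, Nat.add_sub_cancel_left, Nat.add_sub_cancel]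
  intro T hT T' hT' hTT'
  have key : ∀ S ∈ ((V \ A).erase e).powersetCard s, e ∉ S := fun S hS h =>
    (mem_erase.1 ((mem_powersetCard.1 hS).1 h)).1 rfl
  rw [← erase_insert (key T hT), ← erase_insert (key T' hT')]
  exact congrArg (fun S => S.erase e) hTT'

lemma card_add_choose_le_of_meets (hA : A ⊆ V) (hAa : #A = a) (hV : #V = a + c)
    (h𝒢 : 𝒢 ⊆ V.powersetCard r) (hGA : ∀ T ∈ 𝒢, ¬ Disjoint T A) :
    #𝒢 + c.choose r ≤ (#V).choose r := by
  rw [← card_filter_disjoint (r := r) hA hAa hV, ← card_powersetCard, ← card_union_of_disjoint]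
  · exact card_le_card (union_subset h𝒢 (filter_subset _ _))
  · exact disjoint_left.2 fun T hT hTd => hGA T hT (mem_filter.1 hTd).2

/-- A bound for the number of sets meeting both `A` and `B`. Each further set that meets `A`, and
that avoids `e ∈ A \ B` if it misses `B`, improves the bound by one. -/
lemma card_add_choose_add_choose_add_card_le {e : ℕ} {ℋ : Finset (Finset ℕ)} (hA : A ⊆ V)
    (hAa : #A = a) (hB : B ⊆ V) (hBa : #B = a) (heA : e ∈ A) (heB : e ∉ B)
    (hV : #V = a + (c + 1)) (h𝒢 : 𝒢 ⊆ V.powersetCard (s + 1))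
    (hGA : ∀ T ∈ 𝒢, ¬ Disjoint T A) (hGB : ∀ T ∈ 𝒢, ¬ Disjoint T B)
    (hℋ : ℋ ⊆ V.powersetCard (s + 1)) (hHG : Disjoint 𝒢 ℋ) (hHA : ∀ T ∈ ℋ, ¬ Disjoint T A)
    (hHB : ∀ T ∈ ℋ, Disjoint T B → e ∉ T) :
    #𝒢 + (c + 1).choose (s + 1) + c.choose s + #ℋ ≤ (#V).choose (s + 1) := by
  rw [← card_filter_disjoint (r := s + 1) hA hAa hV,
    ← card_filter_disjoint_mem (s := s) hB hBa hV (hA heA) heB, ← card_powersetCard,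
    ← card_union_of_disjoint, ← card_union_of_disjoint, ← card_union_of_disjoint]
  · exact card_le_card (union_subset (union_subset (union_subset h𝒢 (filter_subset _ _))
      (filter_subset _ _)) hℋ)
  · refine disjoint_left.2 fun T hT hT' => ?_
    simp only [mem_union, mem_filter] at hT
    rcases hT with (hT | hT) | hT
    · exact disjoint_left.1 hHG hT hT'
    · exact hHA T hT' hT.2
    · exact hHB T hT' hT.2.1 hT.2.2
  · refine disjoint_left.2 fun T hT hT' => ?_
    simp only [mem_union, mem_filter] at hT hT'
    rcases hT with hT | hT
    · exact hGB T hT hT'.2.1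
    · exact disjoint_left.1 hT.2 hT'.2.2 heA
  · exact disjoint_left.2 fun T hT hT' => hGA T hT (mem_filter.1 hT').2

lemma exists_mem_notMem_of_ne (hAa : #A = a) (hBa : #B = a) (h : A ≠ B) : ∃ e ∈ A, e ∉ B := by
  by_contra! hcon
  exact h (eq_of_subset_of_card_le hcon (by omega))

lemma card_add_choose_add_choose_le_of_meets_two (hA : A ⊆ V) (hAa : #A = a) (hB : B ⊆ V)
    (hBa : #B = a) (hAB : A ≠ B) (hV : #V = a + (c + 1)) (h𝒢 : 𝒢 ⊆ V.powersetCard (s + 1))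
    (hGA : ∀ T ∈ 𝒢, ¬ Disjoint T A) (hGB : ∀ T ∈ 𝒢, ¬ Disjoint T B) :
    #𝒢 + (c + 1).choose (s + 1) + c.choose s ≤ (#V).choose (s + 1) := by
  obtain ⟨e, heA, heB⟩ := exists_mem_notMem_of_ne hAa hBa hAB
  simpa using card_add_choose_add_choose_add_card_le (ℋ := ∅) hA hAa hB hBa heA heB hV h𝒢 hGA hGB
    (empty_subset _) (disjoint_empty_right _) (by simp) (by simp)

lemma card_add_choose_add_choose_lt_of_meets_three (hA : A ⊆ V) (hAa : #A = a) (hB : B ⊆ V)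
    (hBa : #B = a) (hC : C ⊆ V) (hCa : #C = a) (hAB : A ≠ B) (hAC : A ≠ C) (hBC : B ≠ C)
    (hV : #V = a + (c + 1)) (hs : 1 ≤ s) (hsc : s ≤ c) (h𝒢 : 𝒢 ⊆ V.powersetCard (s + 1))
    (hGA : ∀ T ∈ 𝒢, ¬ Disjoint T A) (hGB : ∀ T ∈ 𝒢, ¬ Disjoint T B)
    (hGC : ∀ T ∈ 𝒢, ¬ Disjoint T C) :
    #𝒢 + (c + 1).choose (s + 1) + c.choose s < (#V).choose (s + 1) := by
  obtain ⟨e, heA, heB⟩ := exists_mem_notMem_of_ne hAa hBa hAB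
  obtain ⟨f, hfA, hfC⟩ := exists_mem_notMem_of_ne hAa hCa hAC
  obtain ⟨g, hgB, hgC⟩ := exists_mem_notMem_of_ne hBa hCa hBC
  obtain ⟨T, hfgT, hTV, hT⟩ := exists_subsuperset_card_eq (s := {f, g}) (t := V \ C) (n := s + 1)
    (by
      intro z hz
      rcases mem_insert.1 hz with rfl | hz
      · exact mem_sdiff.2 ⟨hA hfA, hfC⟩
      · rw [mem_singleton.1 hz]
        exact mem_sdiff.2 ⟨hB hgB, hgC⟩)
    (card_le_two.trans (by omega))
    (by rw [card_sdiff_of_subset hC]; omega)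
  have hTC := subset_sdiff.1 hTV
  have hfT : f ∈ T := hfgT (by simp)
  have hgT : g ∈ T := hfgT (by simp)
  have := card_add_choose_add_choose_add_card_le (ℋ := {T}) hA hAa hB hBa heA heB hV h𝒢 hGA hGB
    (by simp [mem_powersetCard, hTC.1, hT])
    (disjoint_singleton_right.2 fun h => hGC T h hTC.2)
    (by simpa using not_disjoint_iff.2 ⟨f, hfT, hfA⟩)
    (by simpa using fun h => absurd h (not_disjoint_iff.2 ⟨g, hgT, hgB⟩))
  rw [card_singleton] at this
  omega

lemma card_inter_of_meets_two (hA : A ⊆ V) (hAa : #A = a) (hB : B ⊆ V)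
    (hBa : #B = a) (hAB : A ≠ B) (hV : #V = a + (c + 1)) (hsc : s + 1 ≤ c)
    (h𝒢 : 𝒢 ⊆ V.powersetCard (s + 1))
    (hGA : ∀ T ∈ 𝒢, ¬ Disjoint T A) (hGB : ∀ T ∈ 𝒢, ¬ Disjoint T B)
    (hG : #𝒢 + (c + 1).choose (s + 1) + c.choose s = (#V).choose (s + 1)) :
    #(A ∩ B) + 1 = a := by
  obtain ⟨e, heA, heB⟩ := exists_mem_notMem_of_ne hAa hBa hAB
  suffices h : A \ B = {e} by
    have := card_sdiff_add_card_inter A B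
    rw [h, card_singleton] at this
    omega
  by_contra hne
  obtain ⟨f, hf, hfe⟩ : ∃ f ∈ A \ B, f ≠ e := by
    by_contra! hcon
    exact hne (eq_singleton_iff_unique_mem.2 ⟨mem_sdiff.2 ⟨heA, heB⟩, hcon⟩)
  rw [mem_sdiff] at hf
  obtain ⟨T, hfT, hTV, hT⟩ := exists_subsuperset_card_eq (s := {f}) (t := (V \ B).erase e)
    (n := s + 1) (by simp [hfe, hf.2, hA hf.1]) (by simp)
    (by
      rw [card_erase_of_mem (mem_sdiff.2 ⟨hA heA, heB⟩), card_sdiff_of_subset hB]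
      omega)
  have hTB := subset_sdiff.1 (hTV.trans (erase_subset _ _))
  have heT : e ∉ T := fun h => (mem_erase.1 (hTV h)).1 rfl
  have := card_add_choose_add_choose_add_card_le (ℋ := {T}) hA hAa hB hBa heA heB hV h𝒢 hGA hGB
    (by simp [mem_powersetCard, hTB.1, hT])
    (disjoint_singleton_right.2 fun h => hGB T h hTB.2)
    (by simpa using not_disjoint_iff.2 ⟨f, singleton_subset_iff.1 hfT, hf.1⟩)
    (by simp [heT])
  rw [card_singleton] at this
  omega

end Counting

section Shift

variable {V : Finset ℕ} {P Q : Finset (Finset ℕ)} {i v x k : ℕ}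

/-- `P` is stable under replacing `v` by any other element of `V`. -/
def ReplacementClosed (V : Finset ℕ) (v : ℕ) (P : Finset (Finset ℕ)) : Prop :=
  ∀ A ∈ P, v ∈ A → ∀ i ∈ V, i ∉ A → insert i (A.erase v) ∈ P

lemma compress_singleton (hiv : i ≠ v) (A : Finset ℕ) :
    UV.compress {i} {v} A = if v ∈ A ∧ i ∉ A then insert i (A.erase v) else A := by
  unfold UV.compress
  by_cases hv : v ∈ A <;> by_cases hi : i ∈ A <;> simp [hv, hi]
  ext z
  simp only [mem_sdiff, mem_singleton, mem_insert, mem_erase]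
  constructor
  · tauto
  · rintro (rfl | h) <;> tauto

lemma mem_shift (hiv : i ≠ v) {B : Finset ℕ} :
    B ∈ 𝓒 {i} {v} P ↔ (B ∈ P ∧ (v ∈ B → i ∉ B → insert i (B.erase v) ∈ P)) ∨
      (B ∉ P ∧ ∃ A ∈ P, v ∈ A ∧ i ∉ A ∧ insert i (A.erase v) = B) := by
  rw [UV.mem_compression]
  simp only [compress_singleton hiv]
  refine or_congr (and_congr_right fun hB => ?_) (and_congr_right fun hB => ?_)
  · split_ifs with h <;> tauto
  · refine exists_congr fun A => and_congr_right fun hA => ?_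
    split_ifs with h
    · tauto
    · exact ⟨fun h' => absurd (h' ▸ hA) hB, fun h' => absurd ⟨h'.1, h'.2.1⟩ h⟩

lemma shift_subset_powersetCard (hiv : i ≠ v) (hi : i ∈ V) (hP : P ⊆ V.powersetCard k) :
    𝓒 {i} {v} P ⊆ V.powersetCard k := by
  intro B hB
  rcases (mem_shift hiv).1 hB with h | ⟨-, A, hA, hvA, hiA, rfl⟩
  · exact hP h.1
  · obtain ⟨hAV, hAk⟩ := mem_powersetCard.1 (hP hA)
    refine mem_powersetCard.2 ⟨insert_subset hi ((erase_subset _ _).trans hAV), ?_⟩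
    rw [card_insert_of_notMem (fun h => hiA (mem_of_mem_erase h)), card_erase_add_one hvA, hAk]

lemma CrossIntersecting.symm (h : CrossIntersecting P Q) : CrossIntersecting Q P :=
  fun A hA B hB => inter_comm B A ▸ h B hB A hA

lemma CrossIntersecting.not_disjoint (h : CrossIntersecting P Q) {A B : Finset ℕ} (hA : A ∈ P)
    (hB : B ∈ Q) : ¬ Disjoint A B :=
  not_disjoint_iff_nonempty_inter.2 (h A hA B hB)

private lemma inter_shifted_nonempty (hiv : i ≠ v) (hPQ : CrossIntersecting P Q)
    {A B : Finset ℕ} (hA : A ∈ P) (hA' : v ∈ A → i ∉ A → insert i (A.erase v) ∈ P)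
    (hB : B ∈ Q) (hiB : i ∉ B) : (A ∩ insert i (B.erase v)).Nonempty := by
  by_cases hiA : i ∈ A
  · exact ⟨i, by simp [hiA]⟩
  by_cases hvA : v ∈ A
  · obtain ⟨z, hz⟩ := hPQ _ (hA' hvA hiA) B hB
    rw [mem_inter, mem_insert, mem_erase] at hz
    refine ⟨z, ?_⟩
    rw [mem_inter, mem_insert, mem_erase]
    rcases hz with ⟨rfl | hz, hzB⟩
    · exact absurd hzB hiB
    · exact ⟨hz.2, Or.inr ⟨hz.1, hzB⟩⟩
  · obtain ⟨z, hz⟩ := hPQ A hA B hB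
    rw [mem_inter] at hz
    refine ⟨z, ?_⟩
    rw [mem_inter, mem_insert, mem_erase]
    exact ⟨hz.1, Or.inr ⟨fun h => hvA (h ▸ hz.1), hz.2⟩⟩

lemma CrossIntersecting.shift (hiv : i ≠ v) (hPQ : CrossIntersecting P Q) :
    CrossIntersecting (𝓒 {i} {v} P) (𝓒 {i} {v} Q) := by
  intro A hA B hB
  rcases (mem_shift hiv).1 hA with hA | ⟨-, A, hA', -, hiA, rfl⟩ <;>
    rcases (mem_shift hiv).1 hB with hB | ⟨-, B, hB', -, hiB, rfl⟩
  · exact hPQ A hA.1 B hB.1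
  · exact inter_shifted_nonempty hiv hPQ hA.1 hA.2 hB' hiB
  · rw [inter_comm]
    exact inter_shifted_nonempty hiv hPQ.symm hB.1 hB.2 hA' hiA
  · exact ⟨i, by simp⟩

lemma filter_mem_shift_subset (hiv : i ≠ v) :
    {A ∈ 𝓒 {i} {v} P | v ∈ A} ⊆ {A ∈ P | v ∈ A} := by
  intro B hB
  rw [mem_filter] at hB ⊢
  rcases (mem_shift hiv).1 hB.1 with h | ⟨-, A, hA, hvA, hiA, rfl⟩
  · exact ⟨h.1, hB.2⟩
  · simp [hiv.symm] at hB

lemma card_filter_mem_shift_lt (hiv : i ≠ v) {A : Finset ℕ} (hA : A ∈ P) (hvA : v ∈ A)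
    (hiA : i ∉ A) (hA' : insert i (A.erase v) ∉ P) :
    #{A ∈ 𝓒 {i} {v} P | v ∈ A} < #{A ∈ P | v ∈ A} := by
  refine card_lt_card ((ssubset_iff_of_subset (filter_mem_shift_subset hiv)).2
    ⟨A, mem_filter.2 ⟨hA, hvA⟩, fun h => ?_⟩)
  rcases (mem_shift hiv).1 (mem_filter.1 h).1 with h | h
  · exact hA' (h.2 hvA hiA)
  · exact h.1 hA

lemma exists_not_shifted (hP : ¬ ReplacementClosed V v P) :
    ∃ A ∈ P, v ∈ A ∧ ∃ i ∈ V, i ∉ A ∧ i ≠ v ∧ insert i (A.erase v) ∉ P := by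
  unfold ReplacementClosed at hP
  push Not at hP
  obtain ⟨A, hA, hvA, i, hi, hiA, hA'⟩ := hP
  exact ⟨A, hA, hvA, i, hi, hiA, fun h => hiA (h ▸ hvA), hA'⟩

theorem exists_replacementClosed_pair (v : ℕ) (hP : P ⊆ V.powersetCard k)
    (hQ : Q ⊆ V.powersetCard k) (hPQ : CrossIntersecting P Q) :
    ∃ P' Q', P' ⊆ V.powersetCard k ∧ Q' ⊆ V.powersetCard k ∧ CrossIntersecting P' Q' ∧
      #P' = #P ∧ #Q' = #Q ∧ ReplacementClosed V v P' ∧ ReplacementClosed V v Q' := by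
  induction hd : #{A ∈ P | v ∈ A} + #{A ∈ Q | v ∈ A} using Nat.strong_induction_on
    generalizing P Q with
  | _ d ih =>
    have step : ∀ i ∈ V, i ≠ v → #{A ∈ 𝓒 {i} {v} P | v ∈ A} + #{A ∈ 𝓒 {i} {v} Q | v ∈ A} < d →
        ∃ P' Q', P' ⊆ V.powersetCard k ∧ Q' ⊆ V.powersetCard k ∧ CrossIntersecting P' Q' ∧
          #P' = #P ∧ #Q' = #Q ∧ ReplacementClosed V v P' ∧ ReplacementClosed V v Q' := by
      intro i hi hiv hlt
      obtain ⟨P', Q', h₁, h₂, h₃, h₄, h₅, h₆⟩ := ih _ hlt (shift_subset_powersetCard hiv hi hP)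
        (shift_subset_powersetCard hiv hi hQ) (hPQ.shift hiv) rfl
      exact ⟨P', Q', h₁, h₂, h₃, h₄.trans (UV.card_compression _ _ _),
        h₅.trans (UV.card_compression _ _ _), h₆⟩
    by_cases hPc : ReplacementClosed V v P
    · by_cases hQc : ReplacementClosed V v Q
      · exact ⟨P, Q, hP, hQ, hPQ, rfl, rfl, hPc, hQc⟩
      · obtain ⟨A, hA, hvA, i, hi, hiA, hiv, hA'⟩ := exists_not_shifted hQc
        have h₁ := card_filter_mem_shift_lt hiv hA hvA hiA hA'
        have h₂ := card_le_card (filter_mem_shift_subset (P := P) hiv)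
        exact step i hi hiv (by omega)
    · obtain ⟨A, hA, hvA, i, hi, hiA, hiv, hA'⟩ := exists_not_shifted hPc
      have h₁ := card_filter_mem_shift_lt hiv hA hvA hiA hA'
      have h₂ := card_le_card (filter_mem_shift_subset (P := Q) hiv)
      exact step i hi hiv (by omega)

lemma nonMemberSubfamily_shift_of_ne (hiv : i ≠ v) (hxi : x ≠ i) (hxv : x ≠ v) :
    (𝓒 {i} {v} P).nonMemberSubfamily x = 𝓒 {i} {v} (P.nonMemberSubfamily x) := by
  have key : ∀ A : Finset ℕ, x ∈ insert i (A.erase v) ↔ x ∈ A := by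
    intro A
    simp [hxi, hxv]
  ext B
  simp only [mem_nonMemberSubfamily, mem_shift hiv, key]
  constructor
  · rintro ⟨h | ⟨hB, A, hA, hvA, hiA, rfl⟩, hx⟩
    · exact Or.inl ⟨⟨h.1, hx⟩, fun h₁ h₂ => ⟨h.2 h₁ h₂, hx⟩⟩
    · rw [key] at hx
      exact Or.inr ⟨fun h => hB h.1, A, ⟨hA, hx⟩, hvA, hiA, rfl⟩
  · rintro (h | ⟨hB, A, hA, hvA, hiA, rfl⟩)
    · exact ⟨Or.inl ⟨h.1.1, fun h₁ h₂ => (h.2 h₁ h₂).1⟩, h.1.2⟩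
    · rw [key] at hB ⊢
      exact ⟨Or.inr ⟨fun h => hB ⟨h, hA.2⟩, A, hA.1, hvA, hiA, rfl⟩, hA.2⟩

lemma le_card_nonMemberSubfamily_shift {t : ℕ} (hiv : i ≠ v)
    (hx : t ≤ #(P.nonMemberSubfamily x))
    (hi : t ≤ #((P.nonMemberSubfamily i).nonMemberSubfamily v)) :
    t ≤ #((𝓒 {i} {v} P).nonMemberSubfamily x) := by
  rcases eq_or_ne x i with rfl | hxi
  · refine hi.trans (card_le_card fun B hB => ?_)
    simp only [mem_nonMemberSubfamily] at hB ⊢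
    exact ⟨(mem_shift hiv).2 (Or.inl ⟨hB.1.1, fun h => absurd h hB.2⟩), hB.1.2⟩
  rcases eq_or_ne x v with rfl | hxv
  · refine hx.trans (card_le_card fun B hB => ?_)
    simp only [mem_nonMemberSubfamily] at hB ⊢
    exact ⟨(mem_shift hiv).2 (Or.inl ⟨hB.1, fun h => absurd h hB.2⟩), hB.2⟩
  · rw [nonMemberSubfamily_shift_of_ne hiv hxi hxv, UV.card_compression]
    exact hx

theorem exists_replacementClosed_or {t : ℕ} (v : ℕ) (hP : P ⊆ V.powersetCard k)
    (hPI : CrossIntersecting P P) (ht : ∀ x ∈ V, t ≤ #(P.nonMemberSubfamily x)) :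
    ∃ G ⊆ V.powersetCard k, CrossIntersecting G G ∧ #G = #P ∧
      (∀ x ∈ V, t ≤ #(G.nonMemberSubfamily x)) ∧ (ReplacementClosed V v G ∨
        ∃ x ∈ V, x ≠ v ∧ #((G.nonMemberSubfamily x).nonMemberSubfamily v) < t) := by
  induction hd : #{A ∈ P | v ∈ A} using Nat.strong_induction_on generalizing P with
  | _ d ih =>
    by_cases hPc : ReplacementClosed V v P
    · exact ⟨P, hP, hPI, rfl, ht, Or.inl hPc⟩
    by_cases hx : ∃ x ∈ V, x ≠ v ∧ #((P.nonMemberSubfamily x).nonMemberSubfamily v) < t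
    · exact ⟨P, hP, hPI, rfl, ht, Or.inr hx⟩
    push Not at hx
    obtain ⟨A, hA, hvA, i, hi, hiA, hiv, hA'⟩ := exists_not_shifted hPc
    have hlt := card_filter_mem_shift_lt hiv hA hvA hiA hA'
    obtain ⟨G, hG, hGI, hGP, h⟩ := ih _ (hd ▸ hlt) (shift_subset_powersetCard hiv hi hP)
      (hPI.shift hiv) (fun x hxV => le_card_nonMemberSubfamily_shift hiv (ht x hxV) (hx i hi hiv))
      rfl
    exact ⟨G, hG, hGI, hGP.trans (UV.card_compression _ _ _), h⟩

end Shift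

section Subfamily

variable {V : Finset ℕ} {P Q : Finset (Finset ℕ)} {v x k t : ℕ}

lemma memberSubfamily_subset_powersetCard (hP : P ⊆ V.powersetCard (k + 1)) :
    P.memberSubfamily v ⊆ (V.erase v).powersetCard k := by
  intro A hA
  rw [mem_memberSubfamily] at hA
  obtain ⟨hAV, hAk⟩ := mem_powersetCard.1 (hP hA.1)
  rw [card_insert_of_notMem hA.2] at hAk
  exact mem_powersetCard.2 ⟨subset_erase.2 ⟨(subset_insert _ _).trans hAV, hA.2⟩, by omega⟩

lemma nonMemberSubfamily_subset_powersetCard (hP : P ⊆ V.powersetCard k) :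
    P.nonMemberSubfamily v ⊆ (V.erase v).powersetCard k := by
  intro A hA
  rw [mem_nonMemberSubfamily] at hA
  obtain ⟨hAV, hAk⟩ := mem_powersetCard.1 (hP hA.1)
  exact mem_powersetCard.2 ⟨subset_erase.2 ⟨hAV, hA.2⟩, hAk⟩

lemma CrossIntersecting.nonMember (h : CrossIntersecting P Q) :
    CrossIntersecting (P.nonMemberSubfamily v) (Q.nonMemberSubfamily v) := fun A hA B hB =>
  h A (mem_nonMemberSubfamily.1 hA).1 B (mem_nonMemberSubfamily.1 hB).1

lemma CrossIntersecting.not_disjoint_of_mem_member (h : CrossIntersecting P Q) {A B : Finset ℕ}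
    (hA : A ∈ P.memberSubfamily v) (hB : B ∈ Q) (hvB : v ∉ B) : ¬ Disjoint A B := fun hd =>
  h.not_disjoint (mem_memberSubfamily.1 hA).1 hB (disjoint_insert_left.2 ⟨hvB, hd⟩)

lemma CrossIntersecting.member (h : CrossIntersecting P Q) (hP : P ⊆ V.powersetCard (k + 1))
    (hQ : Q ⊆ V.powersetCard (k + 1)) (hPc : ReplacementClosed V v P) (hV : 2 * k + 2 ≤ #V) :
    CrossIntersecting (P.memberSubfamily v) (Q.memberSubfamily v) := by
  intro A hA B hB
  rw [← not_disjoint_iff_nonempty_inter]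
  intro hAB
  have hA' := mem_powersetCard.1 (memberSubfamily_subset_powersetCard hP hA)
  have hB' := mem_powersetCard.1 (memberSubfamily_subset_powersetCard hQ hB)
  rw [mem_memberSubfamily] at hA hB
  obtain ⟨z, hz, hz'⟩ : ∃ z ∈ V, z ∉ insert v (A ∪ B) := by
    apply exists_mem_notMem_of_card_lt_card
    have h₁ := card_insert_le v (A ∪ B)
    have h₂ := card_union_le A B
    omega
  simp only [mem_insert, mem_union, not_or] at hz'
  have hzA := hPc _ hA.1 (mem_insert_self _ _) z hz (by simp [hz'])
  rw [erase_insert hA.2] at hzA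
  refine h.not_disjoint hzA hB.1 ?_
  rw [disjoint_insert_left, disjoint_insert_right]
  simp [hz', hA.2, hAB]

/-- In a `v`-stable family, many sets avoiding `x` give many sets avoiding both `x` and `v`. -/
lemma ReplacementClosed.le_card_nonMember_nonMember (hP : P ⊆ V.powersetCard k)
    (hPc : ReplacementClosed V v P) (htV : k + 1 + t ≤ #V) {ℬ : Finset (Finset ℕ)}
    (hℬ : ℬ ⊆ P) (ht : t ≤ #ℬ) (hx : ∀ A ∈ ℬ, x ∉ A) :
    t ≤ #((P.nonMemberSubfamily v).nonMemberSubfamily x) := by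
  by_cases h : ∃ A ∈ ℬ, v ∈ A
  · obtain ⟨A, hA, hvA⟩ := h
    obtain ⟨hAV, hAk⟩ := mem_powersetCard.1 (hP (hℬ hA))
    have hsub : ((V \ A).erase x).image (fun i => insert i (A.erase v)) ⊆
        (P.nonMemberSubfamily v).nonMemberSubfamily x := by
      intro B hB
      obtain ⟨i, hi, rfl⟩ := mem_image.1 hB
      simp only [mem_erase, mem_sdiff] at hi
      have hvi : v ≠ i := fun h => hi.2.2 (h ▸ hvA)
      simp [mem_nonMemberSubfamily, hPc A (hℬ hA) hvA i hi.2.1 hi.2.2, hvi, hx A hA, hi.1.symm]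
    refine le_trans ?_ (card_le_card hsub)
    rw [card_image_of_injOn]
    · have := pred_card_le_card_erase (s := V \ A) (a := x)
      rw [card_sdiff_of_subset hAV] at this
      omega
    · intro i hi j hj hij
      simp only [coe_erase, coe_sdiff, Set.mem_sdiff, mem_coe] at hi hj
      have : i ∈ insert j (A.erase v) := by
        rw [← show insert i (A.erase v) = insert j (A.erase v) from hij]
        exact mem_insert_self _ _
      rcases mem_insert.1 this with h | h
      · exact h
      · exact absurd (mem_of_mem_erase h) hi.1.2
  · push Not at h
    refine ht.trans (card_le_card fun A hA => ?_)
    simp [mem_nonMemberSubfamily, hℬ hA, h A hA, hx A hA]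

lemma ReplacementClosed.le_card_nonMember (hP : P ⊆ V.powersetCard k)
    (hPc : ReplacementClosed V v P) (htV : k + 1 + t ≤ #V) (ht : t ≤ #P) :
    t ≤ #(P.nonMemberSubfamily v) := by
  obtain ⟨x, hx⟩ := Infinite.exists_notMem_finset V
  exact (hPc.le_card_nonMember_nonMember hP htV subset_rfl ht fun A hA hxA =>
    hx ((mem_powersetCard.1 (hP hA)).1 hxA)).trans (card_le_card (filter_subset _ _))

end Subfamily

section Cross

variable {V : Finset ℕ} {P Q : Finset (Finset ℕ)} {l s w : ℕ}

lemma CrossIntersecting.card_add_card_le (hP : P ⊆ V.powersetCard l) (hQ : Q ⊆ V.powersetCard l)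
    (hPQ : CrossIntersecting P Q) (hV : #V = l + l) : #P + #Q ≤ (l + l).choose l := by
  have hinj : Set.InjOn (fun B => V \ B) (Q : Set (Finset ℕ)) := by
    intro B hB B' hB' h
    have h₁ := (mem_powersetCard.1 (hQ hB)).1
    have h₂ := (mem_powersetCard.1 (hQ hB')).1
    rw [← Finset.sdiff_sdiff_eq_self h₁, ← Finset.sdiff_sdiff_eq_self h₂]
    exact congrArg (fun S => V \ S) h
  rw [← hV, ← card_powersetCard, ← card_image_of_injOn hinj, ← card_union_of_disjoint]
  · refine card_le_card (union_subset hP fun A hA => ?_)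
    obtain ⟨B, hB, rfl⟩ := mem_image.1 hA
    obtain ⟨hBV, hBl⟩ := mem_powersetCard.1 (hQ hB)
    exact mem_powersetCard.2 ⟨sdiff_subset, by rw [card_sdiff_of_subset hBV]; omega⟩
  · refine disjoint_left.2 fun A hA hA' => ?_
    obtain ⟨B, hB, rfl⟩ := mem_image.1 hA'
    exact hPQ.not_disjoint hA hB sdiff_disjoint

lemma CrossIntersecting.card_member_add_choose_le {v : ℕ} (hPQ : CrossIntersecting P Q)
    (hP : P ⊆ V.powersetCard (l + 1)) (hQ : Q ⊆ V.powersetCard (l + 1)) (hv : v ∈ V)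
    (hV : #V = l + 1 + (w + 1)) (hQn : 1 ≤ #(Q.nonMemberSubfamily v)) :
    #(P.memberSubfamily v) + w.choose l ≤ (l + 1 + w).choose l := by
  obtain ⟨B, hB⟩ := card_pos.1 hQn
  obtain ⟨hBV, hBl⟩ := mem_powersetCard.1 (nonMemberSubfamily_subset_powersetCard hQ hB)
  have hV' : #(V.erase v) = l + 1 + w := by rw [card_erase_of_mem hv]; omega
  rw [mem_nonMemberSubfamily] at hB
  have := card_add_choose_le_of_meets hBV hBl hV' (memberSubfamily_subset_powersetCard hP)
    fun T hT => hPQ.not_disjoint_of_mem_member hT hB.1 hB.2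
  rwa [hV'] at this

theorem CrossIntersecting.card_add_card_add_choose_le (hP : P ⊆ V.powersetCard l)
    (hQ : Q ⊆ V.powersetCard l) (hPQ : CrossIntersecting P Q) (hPn : 1 ≤ #P) (hQn : 1 ≤ #Q)
    (hV : #V = l + w) (hlw : l ≤ w) : #P + #Q + w.choose l ≤ (l + w).choose l + 1 := by
  induction hm : l + w using Nat.strong_induction_on generalizing V P Q l w with
  | _ m ih =>
    subst hm
    rcases hlw.eq_or_lt with rfl | hlw
    · have := hPQ.card_add_card_le hP hQ hV
      simpa using this
    obtain _ | l := l
    · obtain ⟨A, hA⟩ := card_pos.1 hPn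
      obtain ⟨B, hB⟩ := card_pos.1 hQn
      have hA0 := card_eq_zero.1 (mem_powersetCard.1 (hP hA)).2
      exact absurd (hPQ A hA B hB) (by simp [hA0])
    obtain _ | w := w
    · omega
    obtain ⟨v, hv⟩ : V.Nonempty := card_pos.1 (by omega)
    obtain ⟨P, Q, hP, hQ, hPQ, hPc, hQc, hPv, hQv⟩ := exists_replacementClosed_pair v hP hQ hPQ
    rw [← hPc] at hPn ⊢
    rw [← hQc] at hQn ⊢
    have hPn' := hPv.le_card_nonMember hP (t := 1) (by omega) hPn
    have hQn' := hQv.le_card_nonMember hQ (t := 1) (by omega) hQn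
    have hV' : #(V.erase v) = l + 1 + w := by rw [card_erase_of_mem hv]; omega
    have h₁ := ih (l + 1 + w) (by omega) (nonMemberSubfamily_subset_powersetCard hP)
      (nonMemberSubfamily_subset_powersetCard hQ) hPQ.nonMember hPn' hQn' hV' (by omega) rfl
    have hcP := card_memberSubfamily_add_card_nonMemberSubfamily v P
    have hcQ := card_memberSubfamily_add_card_nonMemberSubfamily v Q
    have e₁ : (l + 1 + (w + 1)).choose (l + 1) = (l + 1 + w).choose l + (l + 1 + w).choose (l + 1) :=
      Nat.choose_succ_succ _ _
    have e₂ := Nat.choose_succ_succ w l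
    simp only [Nat.succ_eq_add_one] at e₂
    have hPm := hPQ.card_member_add_choose_le hP hQ hv hV hQn'
    have hQm := hPQ.symm.card_member_add_choose_le hQ hP hv hV hPn'
    rcases Nat.eq_zero_or_pos #(P.memberSubfamily v) with hP0 | hP0
    · omega
    rcases Nat.eq_zero_or_pos #(Q.memberSubfamily v) with hQ0 | hQ0
    · omega
    have h₂ := ih (l + (w + 1)) (by omega) (memberSubfamily_subset_powersetCard hP)
      (memberSubfamily_subset_powersetCard hQ) (hPQ.member hP hQ hPv (by omega)) hP0 hQ0
      (hV'.trans (by omega)) (by omega) rfl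
    rw [show l + (w + 1) = l + 1 + w by omega] at h₂
    obtain _ | l := l
    · simp at h₂
      omega
    have e₃ := Nat.choose_succ_succ w l
    simp only [Nat.succ_eq_add_one] at e₃
    have := Nat.choose_pos (n := w) (k := l) (by omega)
    omega

lemma CrossIntersecting.card_member_add_choose_add_choose_le {v : ℕ} (hPQ : CrossIntersecting P Q)
    (hP : P ⊆ V.powersetCard (s + 2)) (hQ : Q ⊆ V.powersetCard (s + 2)) (hv : v ∈ V)
    (hV : #V = s + 2 + (w + 2)) (hsw : s ≤ w) (hQn : 2 ≤ #(Q.nonMemberSubfamily v)) :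
    #(P.memberSubfamily v) + (w + 1).choose (s + 1) + w.choose s ≤ (s + 2 + (w + 1)).choose (s + 1) ∧
      (1 ≤ s → 3 ≤ #(Q.nonMemberSubfamily v) → #(P.memberSubfamily v) + (w + 1).choose (s + 1) +
        w.choose s < (s + 2 + (w + 1)).choose (s + 1)) := by
  have hV' : #(V.erase v) = s + 2 + (w + 1) := by rw [card_erase_of_mem hv]; omega
  have key : ∀ B ∈ Q.nonMemberSubfamily v, B ⊆ V.erase v ∧ #B = s + 2 ∧
      ∀ T ∈ P.memberSubfamily v, ¬ Disjoint T B := by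
    intro B hB
    obtain ⟨hBV, hBl⟩ := mem_powersetCard.1 (nonMemberSubfamily_subset_powersetCard hQ hB)
    rw [mem_nonMemberSubfamily] at hB
    exact ⟨hBV, hBl, fun T hT => hPQ.not_disjoint_of_mem_member hT hB.1 hB.2⟩
  constructor
  · obtain ⟨A, hA, B, hB, hAB⟩ := one_lt_card.1 hQn
    have := card_add_choose_add_choose_le_of_meets_two (key A hA).1 (key A hA).2.1 (key B hB).1
      (key B hB).2.1 hAB hV' (memberSubfamily_subset_powersetCard hP) (key A hA).2.2 (key B hB).2.2
    rwa [hV'] at this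
  · intro hs hQn
    obtain ⟨A, hA, B, hB, C, hC, hAB, hAC, hBC⟩ := two_lt_card.1 hQn
    have := card_add_choose_add_choose_lt_of_meets_three (key A hA).1 (key A hA).2.1 (key B hB).1
      (key B hB).2.1 (key C hC).1 (key C hC).2.1 hAB hAC hBC hV' hs hsw
      (memberSubfamily_subset_powersetCard hP) (key A hA).2.2 (key B hB).2.2 (key C hC).2.2
    rwa [hV'] at this

lemma two_le_choose {n r : ℕ} (hr : 1 ≤ r) (hrn : r < n) : 2 ≤ n.choose r := by
  obtain ⟨n, rfl⟩ : ∃ m, n = m + 1 := ⟨n - 1, by omega⟩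
  obtain ⟨r, rfl⟩ : ∃ m, r = m + 1 := ⟨r - 1, by omega⟩
  have h₁ := Nat.choose_pos (n := n) (k := r) (by omega)
  have h₂ := Nat.choose_pos (n := n) (k := r + 1) (by omega)
  have := Nat.choose_succ_succ n r
  simp only [Nat.succ_eq_add_one] at this
  omega

theorem CrossIntersecting.card_add_card_add_choose_add_choose_le
    (hP : P ⊆ V.powersetCard (s + 3)) (hQ : Q ⊆ V.powersetCard (s + 3))
    (hPQ : CrossIntersecting P Q) (hPn : 2 ≤ #P) (hQn : 2 ≤ #Q) (hV : #V = s + 3 + (w + 1))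
    (hsw : s + 2 ≤ w) :
    #P + #Q + (w + 1).choose (s + 3) + w.choose (s + 2) ≤ (s + 3 + (w + 1)).choose (s + 3) + 2 ∧
      (1 ≤ s → s + 2 < w → 3 ≤ #P → 3 ≤ #Q → #P + #Q + (w + 1).choose (s + 3) + w.choose (s + 2) <
        (s + 3 + (w + 1)).choose (s + 3) + 2) := by
  induction w generalizing V P Q with
  | zero => omega
  | succ w ih =>
    rcases hsw.eq_or_lt with hsw | hsw
    · obtain rfl : w = s + 1 := by omega
      refine ⟨?_, by omega⟩
      have := hPQ.card_add_card_le hP hQ hV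
      simpa using this
    obtain ⟨v, hv⟩ : V.Nonempty := card_pos.1 (by omega)
    obtain ⟨P, Q, hP, hQ, hPQ, hPc, hQc, hPv, hQv⟩ := exists_replacementClosed_pair v hP hQ hPQ
    rw [← hPc] at hPn ⊢
    rw [← hQc] at hQn ⊢
    have hPn' := hPv.le_card_nonMember hP (t := 2) (by omega) hPn
    have hQn' := hQv.le_card_nonMember hQ (t := 2) (by omega) hQn
    have hV' : #(V.erase v) = s + 3 + (w + 1) := by rw [card_erase_of_mem hv]; omega
    have h₁ := (ih (nonMemberSubfamily_subset_powersetCard hP)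
      (nonMemberSubfamily_subset_powersetCard hQ) hPQ.nonMember hPn' hQn' hV' (by omega)).1
    have hcP := card_memberSubfamily_add_card_nonMemberSubfamily v P
    have hcQ := card_memberSubfamily_add_card_nonMemberSubfamily v Q
    have e₁ : (s + 3 + (w + 1 + 1)).choose (s + 3) =
      (s + 3 + (w + 1)).choose (s + 2) + (s + 3 + (w + 1)).choose (s + 3) := Nat.choose_succ_succ _ _
    have e₂ : (w + 1 + 1).choose (s + 3) = (w + 1).choose (s + 2) + (w + 1).choose (s + 3) :=
      Nat.choose_succ_succ _ _
    have e₃ : (w + 1).choose (s + 2) = w.choose (s + 1) + w.choose (s + 2) :=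
      Nat.choose_succ_succ _ _
    obtain ⟨hPm, hPm'⟩ := hPQ.card_member_add_choose_add_choose_le (s := s + 1) (w := w) hP hQ hv hV
      (by omega) hQn'
    obtain ⟨hQm, hQm'⟩ := hPQ.symm.card_member_add_choose_add_choose_le (s := s + 1) (w := w) hQ hP
      hv hV (by omega) hPn'
    simp only [show s + 1 + 1 = s + 2 from rfl, show s + 1 + 2 = s + 3 from rfl] at hPm hPm' hQm hQm'
    have hstrict : 3 ≤ #P → 3 ≤ #Q → 3 ≤ #(P.nonMemberSubfamily v) ∧
        3 ≤ #(Q.nonMemberSubfamily v) := fun hP₃ hQ₃ =>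
      ⟨hPv.le_card_nonMember hP (by omega) hP₃, hQv.le_card_nonMember hQ (by omega) hQ₃⟩
    rcases Nat.eq_zero_or_pos #(P.memberSubfamily v) with hP0 | hP0
    · refine ⟨by omega, fun hs _ hP₃ hQ₃ => ?_⟩
      have := hQm' (by omega) (hstrict hP₃ hQ₃).1
      omega
    rcases Nat.eq_zero_or_pos #(Q.memberSubfamily v) with hQ0 | hQ0
    · refine ⟨by omega, fun hs _ hP₃ hQ₃ => ?_⟩
      have := hPm' (by omega) (hstrict hP₃ hQ₃).2
      omega
    have h₂ := CrossIntersecting.card_add_card_add_choose_le (w := w + 2)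
      (memberSubfamily_subset_powersetCard hP) (memberSubfamily_subset_powersetCard hQ)
      (hPQ.member hP hQ hPv (by omega)) hP0 hQ0 (hV'.trans (by omega)) (by omega)
    rw [show s + 2 + (w + 2) = s + 3 + (w + 1) by omega] at h₂
    have e₄ : (w + 2).choose (s + 2) = (w + 1).choose (s + 1) + (w + 1).choose (s + 2) :=
      Nat.choose_succ_succ _ _
    have e₅ : (w + 1).choose (s + 1) = w.choose s + w.choose (s + 1) :=
      Nat.choose_succ_succ _ _
    have := Nat.choose_pos (n := w) (k := s) (by omega)
    refine ⟨by omega, fun hs _ _ _ => ?_⟩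
    have := two_le_choose (n := w) hs (by omega)
    omega

end Cross

section Intersecting

variable {V : Finset ℕ} {F : Finset (Finset ℕ)} {k s t u v w x : ℕ}

lemma card_subfamilies (F : Finset (Finset ℕ)) (x v : ℕ) :
    #F = #((F.memberSubfamily x).memberSubfamily v) + #((F.memberSubfamily x).nonMemberSubfamily v)
      + #((F.nonMemberSubfamily x).memberSubfamily v)
      + #((F.nonMemberSubfamily x).nonMemberSubfamily v) := by
  rw [add_assoc, card_memberSubfamily_add_card_nonMemberSubfamily,
    card_memberSubfamily_add_card_nonMemberSubfamily,
    card_memberSubfamily_add_card_nonMemberSubfamily]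

lemma memberSubfamily_nonMemberSubfamily_comm (hxv : x ≠ v) :
    (F.memberSubfamily x).nonMemberSubfamily v = (F.nonMemberSubfamily v).memberSubfamily x := by
  ext A
  simp only [mem_nonMemberSubfamily, mem_memberSubfamily, mem_insert, not_or]
  tauto

lemma CrossIntersecting.member_nonMember (hF : CrossIntersecting F F) :
    CrossIntersecting ((F.memberSubfamily x).nonMemberSubfamily v)
      ((F.nonMemberSubfamily x).memberSubfamily v) := by
  intro A hA B hB
  simp only [mem_nonMemberSubfamily, mem_memberSubfamily, mem_insert, not_or] at hA hB
  rw [← not_disjoint_iff_nonempty_inter]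
  intro hAB
  refine hF.not_disjoint hA.1.1 hB.1.1 ?_
  rw [disjoint_insert_left, disjoint_insert_right]
  simp [hA, hB, hAB]

lemma CrossIntersecting.not_disjoint_of_mem_member_member (hF : CrossIntersecting F F)
    {T E : Finset ℕ} (hT : T ∈ (F.memberSubfamily x).memberSubfamily v) (hE : E ∈ F) (hxE : x ∉ E)
    (hvE : v ∉ E) : ¬ Disjoint T E := fun hd =>
  hF.not_disjoint_of_mem_member (mem_memberSubfamily.1 hT).1 hE hxE
    (disjoint_insert_left.2 ⟨hvE, hd⟩)

lemma card_erase_erase (hx : x ∈ V) (hv : v ∈ V) (hxv : x ≠ v) (hV : #V = w + 2) :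
    #((V.erase x).erase v) = w := by
  rw [card_erase_of_mem (mem_erase.2 ⟨hxv.symm, hv⟩), card_erase_of_mem hx, hV]
  omega

lemma not_one_le_card_nonMember (hF : F ⊆ V.powersetCard 1) (hFI : CrossIntersecting F F)
    (hV : V.Nonempty) : ¬ ∀ x ∈ V, 1 ≤ #(F.nonMemberSubfamily x) := by
  intro h
  obtain ⟨x, hx⟩ := hV
  obtain ⟨A, hA⟩ := card_pos.1 (h x hx)
  rw [mem_nonMemberSubfamily] at hA
  obtain ⟨hAV, hA1⟩ := mem_powersetCard.1 (hF hA.1)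
  obtain ⟨a, rfl⟩ := card_eq_one.1 hA1
  obtain ⟨B, hB⟩ := card_pos.1 (h a (hAV (mem_singleton_self a)))
  rw [mem_nonMemberSubfamily] at hB
  exact hFI.not_disjoint hA.1 hB.1 (disjoint_singleton_left.2 hB.2)

lemma CrossIntersecting.two_mul_card_le (hF : F ⊆ V.powersetCard (k + 1))
    (hFI : CrossIntersecting F F) (hV : #V = k + 1 + (k + 1)) : #F ≤ (k + 1 + k).choose k := by
  have h₁ := hFI.card_add_card_le hF hF hV
  have h₂ : (k + 1 + (k + 1)).choose (k + 1) = (k + 1 + k).choose k + (k + 1 + k).choose (k + 1) :=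
    Nat.choose_succ_succ _ _
  have h₃ : (k + 1 + k).choose k = (k + 1 + k).choose (k + 1) :=
    Nat.choose_symm_of_eq_add (by omega)
  omega

/-- Splitting the sets avoiding `x`, or those avoiding `v`, according to the other element. -/
lemma le_card_member_nonMember (hxv : x ≠ v) (hx : t ≤ #(F.nonMemberSubfamily x))
    (hv : t ≤ #(F.nonMemberSubfamily v)) :
    t ≤ #((F.memberSubfamily x).nonMemberSubfamily v) +
        #((F.nonMemberSubfamily x).nonMemberSubfamily v) ∧
      t ≤ #((F.nonMemberSubfamily x).memberSubfamily v) +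
        #((F.nonMemberSubfamily x).nonMemberSubfamily v) := by
  have h₁ := card_memberSubfamily_add_card_nonMemberSubfamily v (F.nonMemberSubfamily x)
  have h₂ := card_memberSubfamily_add_card_nonMemberSubfamily x (F.nonMemberSubfamily v)
  have h₃ : (F.nonMemberSubfamily v).nonMemberSubfamily x =
      (F.nonMemberSubfamily x).nonMemberSubfamily v := by
    ext A
    simp only [mem_nonMemberSubfamily]
    tauto
  rw [memberSubfamily_nonMemberSubfamily_comm hxv]
  rw [h₃] at h₂
  omega

/-- If every set containing `v` contains `x`, then sets avoiding `x` avoid `v`. -/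
lemma notMem_of_link_star (hstar : #((F.memberSubfamily v).nonMemberSubfamily x) = 0)
    {A : Finset ℕ} (hA : A ∈ F.nonMemberSubfamily x) : v ∉ A := by
  intro hvA
  rw [mem_nonMemberSubfamily] at hA
  refine notMem_empty (A.erase v) (card_eq_zero.1 hstar ▸ ?_)
  simp [mem_nonMemberSubfamily, mem_memberSubfamily, insert_erase hvA, hA]

/-- The Hilton–Milner bound. -/
theorem CrossIntersecting.card_add_choose_le (hF : F ⊆ V.powersetCard (k + 1))
    (hFI : CrossIntersecting F F) (hV : #V = k + 1 + (w + 1)) (hkw : k ≤ w)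
    (hx : ∀ x ∈ V, 1 ≤ #(F.nonMemberSubfamily x)) :
    #F + w.choose k ≤ (k + 1 + w).choose k + 1 := by
  induction hm : k + w using Nat.strong_induction_on generalizing V F k w with
  | _ m ih =>
    subst hm
    have hVn : V.Nonempty := card_pos.1 (by omega)
    obtain _ | k := k
    · exact absurd hx (not_one_le_card_nonMember hF hFI hVn)
    rcases hkw.eq_or_lt with rfl | hkw
    · simpa using hFI.two_mul_card_le hF hV
    obtain _ | w := w
    · omega
    obtain ⟨v, hv⟩ := hVn
    obtain ⟨F, hF, hFI, hFc, hx, hFv⟩ := exists_replacementClosed_or v hF hFI hx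
    rw [← hFc]
    have e₁ : (k + 1 + 1 + (w + 1)).choose (k + 1) =
      (k + 1 + 1 + w).choose k + (k + 1 + 1 + w).choose (k + 1) := Nat.choose_succ_succ _ _
    have e₂ : (w + 1).choose (k + 1) = w.choose k + w.choose (k + 1) := Nat.choose_succ_succ _ _
    rcases hFv with hFv | ⟨x, hxV, hxv, he⟩
    · have hV' : #(V.erase v) = k + 1 + 1 + (w + 1) := by rw [card_erase_of_mem hv]; omega
      have h₁ := ih (k + 1 + w) (by omega) (nonMemberSubfamily_subset_powersetCard hF)
        hFI.nonMember hV' (by omega) (fun x hxV => hFv.le_card_nonMember_nonMember hF (by omega)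
          (filter_subset _ _) (hx x (mem_of_mem_erase hxV))
          fun A hA => (mem_nonMemberSubfamily.1 hA).2) rfl
      have hc := card_memberSubfamily_add_card_nonMemberSubfamily v F
      have hFm := hFI.member hF hF hFv (by omega)
      have hmV := memberSubfamily_subset_powersetCard (v := v) hF
      by_cases hst : ∀ x ∈ V.erase v, 1 ≤ #((F.memberSubfamily v).nonMemberSubfamily x)
      · obtain _ | k := k
        · exact absurd hst (not_one_le_card_nonMember hmV hFm (card_pos.1 (by omega)))
        have h₂ := ih (k + 1 + (w + 1)) (by omega) hmV hFm (w := w + 1) (by omega) (by omega) hst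
          (by omega)
        rw [show k + 1 + 1 + (w + 1) = k + 1 + 1 + 1 + w by omega] at h₂
        have e₃ : (w + 1).choose (k + 1) = w.choose k + w.choose (k + 1) :=
          Nat.choose_succ_succ _ _
        have := Nat.choose_pos (n := w) (k := k) (by omega)
        omega
      · push Not at hst
        obtain ⟨x, hxV, hst⟩ := hst
        have hst0 : #((F.memberSubfamily v).nonMemberSubfamily x) = 0 := by omega
        obtain ⟨hxv, hxV⟩ := mem_erase.1 hxV
        obtain ⟨A, hA⟩ := card_pos.1 (hx x hxV)
        have hvA := notMem_of_link_star hst0 hA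
        rw [mem_nonMemberSubfamily] at hA
        obtain ⟨hAV, hAk⟩ := mem_powersetCard.1 (hF hA.1)
        have hV'' := card_erase_erase (w := k + 1 + 1 + w) hv hxV hxv.symm (by omega)
        have h₂ := card_add_choose_le_of_meets (subset_erase.2 ⟨subset_erase.2 ⟨hAV, hvA⟩, hA.2⟩)
          hAk hV'' (memberSubfamily_subset_powersetCard hmV)
          fun T hT => hFI.not_disjoint_of_mem_member_member hT hA.1 hvA hA.2
        rw [hV''] at h₂
        have hc' := card_memberSubfamily_add_card_nonMemberSubfamily x (F.memberSubfamily v)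
        omega
    · have he0 : #((F.nonMemberSubfamily x).nonMemberSubfamily v) = 0 := by omega
      obtain ⟨hP1, hQ1⟩ := le_card_member_nonMember hxv (hx x hxV) (hx v hv)
      rw [he0] at hP1 hQ1
      have hV'' := card_erase_erase (w := k + 1 + (w + 1)) hxV hv hxv (by omega)
      have h₁ := hFI.member_nonMember.card_add_card_add_choose_le (w := w + 1)
        (nonMemberSubfamily_subset_powersetCard (memberSubfamily_subset_powersetCard hF))
        (memberSubfamily_subset_powersetCard (nonMemberSubfamily_subset_powersetCard hF))
        hP1 hQ1 hV'' (by omega)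
      have h₂ := card_le_card (memberSubfamily_subset_powersetCard (v := v)
        (memberSubfamily_subset_powersetCard (v := x) hF))
      rw [card_powersetCard, hV''] at h₂
      rw [show k + 1 + (w + 1) = k + 1 + 1 + w by omega] at h₁ h₂
      have := card_subfamilies F x v
      omega

/-- The bound in the case where at most two sets avoid both `x` and `v`. -/
lemma CrossIntersecting.card_le_of_few_avoiding_pair (hF : F ⊆ V.powersetCard (s + 4))
    (hFI : CrossIntersecting F F) (hV : #V = s + 4 + (t + 3)) (hst : s + 2 ≤ t)
    (hx : ∀ x ∈ V, 3 ≤ #(F.nonMemberSubfamily x)) (hv : v ∈ V) (hxV : x ∈ V) (hxv : x ≠ v)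
    (he : #((F.nonMemberSubfamily x).nonMemberSubfamily v) < 3) :
    #F + (t + 2).choose (s + 3) + (t + 1).choose (s + 2) ≤ (s + 4 + (t + 2)).choose (s + 3) + 2 ∧
      (1 ≤ s → #F + (t + 2).choose (s + 3) + (t + 1).choose (s + 2) <
        (s + 4 + (t + 2)).choose (s + 3) + 2) := by
  obtain ⟨hP3, hQ3⟩ := le_card_member_nonMember hxv (hx x hxV) (hx v hv)
  have hV'' := card_erase_erase (w := s + 4 + (t + 1)) hxV hv hxv (by omega)
  have hPV := nonMemberSubfamily_subset_powersetCard (v := v)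
    (memberSubfamily_subset_powersetCard (v := x) hF)
  have hQV := memberSubfamily_subset_powersetCard (v := v)
    (nonMemberSubfamily_subset_powersetCard (v := x) hF)
  have hRV := memberSubfamily_subset_powersetCard (v := v)
    (memberSubfamily_subset_powersetCard (v := x) hF)
  have hc := card_subfamilies F x v
  have hPQ := hFI.member_nonMember (x := x) (v := v)
  have hR := card_le_card hRV
  rw [card_powersetCard, hV''] at hR
  have e₁ : (s + 4 + (t + 2)).choose (s + 3) =
    (s + 4 + (t + 1)).choose (s + 2) + (s + 4 + (t + 1)).choose (s + 3) := Nat.choose_succ_succ _ _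
  have key : ∀ E ∈ (F.nonMemberSubfamily x).nonMemberSubfamily v, E ⊆ (V.erase x).erase v ∧
      #E = s + 4 ∧ ∀ T ∈ (F.memberSubfamily x).memberSubfamily v, ¬ Disjoint T E := by
    intro E hE
    simp only [mem_nonMemberSubfamily] at hE
    obtain ⟨hEV, hEk⟩ := mem_powersetCard.1 (hF hE.1.1)
    exact ⟨subset_erase.2 ⟨subset_erase.2 ⟨hEV, hE.1.2⟩, hE.2⟩, hEk,
      fun T hT => hFI.not_disjoint_of_mem_member_member hT hE.1.1 hE.1.2 hE.2⟩
  by_cases he2 : #((F.nonMemberSubfamily x).nonMemberSubfamily v) = 2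
  · obtain ⟨A, hA, B, hB, hAB⟩ := one_lt_card.1
      (show 1 < #((F.nonMemberSubfamily x).nonMemberSubfamily v) by omega)
    have h₁ := hPQ.card_add_card_add_choose_le (w := t + 2) hPV hQV (by omega) (by omega)
      (hV''.trans (by omega)) (by omega)
    have h₂ := card_add_choose_add_choose_le_of_meets_two (key A hA).1 (key A hA).2.1 (key B hB).1
      (key B hB).2.1 hAB hV'' hRV (key A hA).2.2 (key B hB).2.2
    rw [show s + 3 + (t + 2) = s + 4 + (t + 1) by omega] at h₁
    simp only [hV'', show s + 1 + 1 = s + 2 from rfl] at h₂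
    have := two_le_choose (n := t) (r := s + 1) (by omega) (by omega)
    omega
  have h₁ := hPQ.card_add_card_add_choose_add_choose_le (w := t + 1) hPV hQV (by omega) (by omega)
    (hV''.trans (by omega)) (by omega)
  rw [show s + 3 + (t + 1 + 1) = s + 4 + (t + 1) by omega, show t + 1 + 1 = t + 2 from rfl] at h₁
  obtain ⟨h₁, h₁'⟩ := h₁
  by_cases he0 : #((F.nonMemberSubfamily x).nonMemberSubfamily v) = 0
  · refine ⟨by omega, fun hs => ?_⟩
    have := h₁' hs (by omega) (by omega) (by omega)
    omega
  · obtain ⟨A, hA⟩ := card_pos.1 (Nat.pos_of_ne_zero he0)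
    have h₂ := card_add_choose_le_of_meets (key A hA).1 (key A hA).2.1 hV'' hRV (key A hA).2.2
    rw [hV''] at h₂
    have := two_le_choose (n := t + 1) (r := s + 2) (by omega) (by omega)
    omega

/-- The bound for diversity at least three; it is never attained when `k = s + 4 ≥ 5` and
`n > 2k`. -/
theorem CrossIntersecting.card_le_of_three_le (hF : F ⊆ V.powersetCard (s + 4))
    (hFI : CrossIntersecting F F) (hV : #V = s + 4 + (u + 2)) (hsu : s + 2 ≤ u)
    (hx : ∀ x ∈ V, 3 ≤ #(F.nonMemberSubfamily x)) :
    #F + (u + 1).choose (s + 3) + u.choose (s + 2) ≤ (s + 4 + (u + 1)).choose (s + 3) + 2 ∧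
      (1 ≤ s → s + 2 < u → #F + (u + 1).choose (s + 3) + u.choose (s + 2) <
        (s + 4 + (u + 1)).choose (s + 3) + 2) := by
  induction u generalizing V F with
  | zero => omega
  | succ t ih =>
    rcases hsu.eq_or_lt with hst | hst
    · obtain rfl : t = s + 1 := by omega
      refine ⟨?_, by omega⟩
      simpa using hFI.two_mul_card_le hF hV
    obtain ⟨v, hv⟩ : V.Nonempty := card_pos.1 (by omega)
    obtain ⟨F, hF, hFI, hFc, hx, hFv⟩ := exists_replacementClosed_or v hF hFI hx
    rw [← hFc]
    rcases hFv with hFv | ⟨x, hxV, hxv, he⟩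
    swap
    · have := hFI.card_le_of_few_avoiding_pair hF hV (by omega) hx hv hxV hxv he
      exact ⟨this.1, fun hs _ => this.2 hs⟩
    have e₁ : (s + 4 + (t + 1 + 1)).choose (s + 3) =
      (s + 4 + (t + 1)).choose (s + 2) + (s + 4 + (t + 1)).choose (s + 3) :=
      Nat.choose_succ_succ _ _
    have e₂ : (t + 1 + 1).choose (s + 3) = (t + 1).choose (s + 2) + (t + 1).choose (s + 3) :=
      Nat.choose_succ_succ _ _
    have e₃ : (t + 1).choose (s + 2) = t.choose (s + 1) + t.choose (s + 2) :=
      Nat.choose_succ_succ _ _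
    have hV' : #(V.erase v) = s + 4 + (t + 2) := by rw [card_erase_of_mem hv]; omega
    have h₁ := (ih (nonMemberSubfamily_subset_powersetCard hF) hFI.nonMember hV' (by omega)
      fun x hxV => hFv.le_card_nonMember_nonMember hF (by omega) (filter_subset _ _)
        (hx x (mem_of_mem_erase hxV)) fun A hA => (mem_nonMemberSubfamily.1 hA).2).1
    have hc := card_memberSubfamily_add_card_nonMemberSubfamily v F
    have hFm := hFI.member hF hF hFv (by omega)
    have hmV := memberSubfamily_subset_powersetCard (v := v) hF
    by_cases hstar : ∀ x ∈ V.erase v, 1 ≤ #((F.memberSubfamily v).nonMemberSubfamily x)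
    · have h₂ := hFm.card_add_choose_le (w := t + 2) hmV (by omega) (by omega) hstar
      rw [show s + 2 + 1 + (t + 2) = s + 4 + (t + 1) by omega] at h₂
      have e₄ : (t + 2).choose (s + 2) = (t + 1).choose (s + 1) + (t + 1).choose (s + 2) :=
        Nat.choose_succ_succ _ _
      have e₅ : (t + 1).choose (s + 1) = t.choose s + t.choose (s + 1) :=
        Nat.choose_succ_succ _ _
      have := Nat.choose_pos (n := t) (k := s) (by omega)
      refine ⟨by omega, fun hs _ => ?_⟩
      have := two_le_choose (n := t) hs (by omega)
      omega
    · push Not at hstar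
      obtain ⟨x, hxV, hstar⟩ := hstar
      have hst0 : #((F.memberSubfamily v).nonMemberSubfamily x) = 0 := by omega
      obtain ⟨hxv, hxV⟩ := mem_erase.1 hxV
      have hV'' := card_erase_erase (w := s + 4 + (t + 1)) hv hxV hxv.symm (by omega)
      have key : ∀ A ∈ F.nonMemberSubfamily x, A ⊆ (V.erase v).erase x ∧ #A = s + 4 ∧
          ∀ T ∈ (F.memberSubfamily v).memberSubfamily x, ¬ Disjoint T A := by
        intro A hA
        have hvA := notMem_of_link_star hst0 hA
        rw [mem_nonMemberSubfamily] at hA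
        obtain ⟨hAV, hAk⟩ := mem_powersetCard.1 (hF hA.1)
        exact ⟨subset_erase.2 ⟨subset_erase.2 ⟨hAV, hvA⟩, hA.2⟩, hAk,
          fun T hT => hFI.not_disjoint_of_mem_member_member hT hA.1 hvA hA.2⟩
      obtain ⟨A, hA, B, hB, C, hC, hAB, hAC, hBC⟩ := two_lt_card.1 (hx x hxV)
      have h₂ := card_add_choose_add_choose_lt_of_meets_three (key A hA).1 (key A hA).2.1
        (key B hB).1 (key B hB).2.1 (key C hC).1 (key C hC).2.1 hAB hAC hBC hV'' (by omega)
        (by omega) (memberSubfamily_subset_powersetCard hmV) (key A hA).2.2 (key B hB).2.2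
        (key C hC).2.2
      simp only [hV'', show s + 1 + 1 = s + 2 from rfl] at h₂
      have hc' := card_memberSubfamily_add_card_nonMemberSubfamily x (F.memberSubfamily v)
      omega

end Intersecting

section TwoAvoiding

variable {V A B : Finset ℕ} {F : Finset (Finset ℕ)} {k n s u x : ℕ}

lemma CrossIntersecting.card_le_of_nonMember_pair (hF : F ⊆ V.powersetCard (s + 2))
    (hFI : CrossIntersecting F F) (hxV : x ∈ V) (hV : #V = s + 2 + (u + 2)) (hAB : A ≠ B)
    (hx : F.nonMemberSubfamily x = {A, B}) :
    #F + (u + 1).choose (s + 1) + u.choose s ≤ (s + 2 + (u + 1)).choose (s + 1) + 2 ∧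
      (s + 1 ≤ u →
        #F + (u + 1).choose (s + 1) + u.choose s = (s + 2 + (u + 1)).choose (s + 1) + 2 →
        #(A ∩ B) = s + 1) := by
  have hA : A ∈ F.nonMemberSubfamily x := by simp [hx]
  have hB : B ∈ F.nonMemberSubfamily x := by simp [hx]
  have hA' := mem_powersetCard.1 (nonMemberSubfamily_subset_powersetCard hF hA)
  have hB' := mem_powersetCard.1 (nonMemberSubfamily_subset_powersetCard hF hB)
  rw [mem_nonMemberSubfamily] at hA hB
  have hVx : #(V.erase x) = s + 2 + (u + 1) := by rw [card_erase_of_mem hxV]; omega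
  have hL : F.memberSubfamily x ⊆ (V.erase x).powersetCard (s + 1) :=
    memberSubfamily_subset_powersetCard hF
  have hLA : ∀ T ∈ F.memberSubfamily x, ¬ Disjoint T A := fun T hT =>
    hFI.not_disjoint_of_mem_member hT hA.1 hA.2
  have hLB : ∀ T ∈ F.memberSubfamily x, ¬ Disjoint T B := fun T hT =>
    hFI.not_disjoint_of_mem_member hT hB.1 hB.2
  have hle := card_add_choose_add_choose_le_of_meets_two hA'.1 hA'.2 hB'.1 hB'.2 hAB hVx hL hLA hLB
  have hcard := card_memberSubfamily_add_card_nonMemberSubfamily x F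
  rw [hx, card_pair hAB] at hcard
  rw [hVx] at hle
  refine ⟨by omega, fun hsu h => ?_⟩
  have := card_inter_of_meets_two hA'.1 hA'.2 hB'.1 hB'.2 hAB hVx hsu hL hLA hLB
    (by rw [hVx]; omega)
  omega

lemma exists_perm_of_injOn {S : Finset ℕ} (hS : S ⊆ V) {f : ℕ → ℕ} (hf : Set.InjOn f S)
    (hfV : Set.MapsTo f S V) :
    ∃ σ : Equiv.Perm ℕ, V.image σ = V ∧ ∀ z ∈ S, σ z = f z := by
  obtain ⟨g, hg⟩ := Set.MapsTo.exists_equiv_extend_of_card_eq (α := V) (t := V)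
    (s := {z : V | (z : ℕ) ∈ S}) (f := fun z => f z) (by simp)
    (fun z hz => hfV hz) (fun z hz w hw h => Subtype.ext (hf hz hw h))
  refine ⟨Equiv.Perm.ofSubtype (p := (· ∈ V)) g, ?_, fun z hz => ?_⟩
  · refine eq_of_subset_of_card_le (image_subset_iff.2 fun z hz => ?_)
      (card_image_of_injective _ (Equiv.injective _)).ge
    rw [Equiv.Perm.ofSubtype_apply_of_mem _ hz]
    exact (g ⟨z, hz⟩).2
  · rw [Equiv.Perm.ofSubtype_apply_of_mem _ (hS hz)]
    exact hg ⟨z, hS hz⟩ hz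

lemma exists_perm_standard (hkn : k + 2 ≤ n) (hx : x ∈ Icc 1 n) (hA : A ⊆ (Icc 1 n).erase x)
    (hB : B ⊆ (Icc 1 n).erase x) (hAk : #A = k) (hBk : #B = k) (hAB : #(A ∩ B) + 1 = k) :
    ∃ σ : Equiv.Perm ℕ, (Icc 1 n).image σ = Icc 1 n ∧ σ x = 1 ∧
      A.image σ = Icc 2 (k + 1) ∧ B.image σ = Icc 3 (k + 2) := by
  obtain ⟨a, ha⟩ : ∃ a, A \ B = {a} := card_eq_one.1 (by
    have := card_sdiff_add_card_inter A B; omega)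
  obtain ⟨b, hb⟩ : ∃ b, B \ A = {b} := card_eq_one.1 (by
    have := card_sdiff_add_card_inter B A; rw [inter_comm] at this; omega)
  obtain ⟨e⟩ : Nonempty ((A ∩ B : Finset ℕ) ≃ (Icc 3 (k + 1) : Finset ℕ)) := by
    refine ⟨equivOfCardEq ?_⟩
    rw [Nat.card_Icc]; omega
  have hmemA : ∀ z, z ∈ A ↔ z = a ∨ z ∈ A ∩ B := fun z => by
    have := Finset.ext_iff.1 ha z; simp at this ⊢; tauto
  have hmemB : ∀ z, z ∈ B ↔ z = b ∨ z ∈ A ∩ B := fun z => by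
    have := Finset.ext_iff.1 hb z; simp at this ⊢; tauto
  have haAB : a ∈ A ∧ a ∉ B := by simpa using Finset.ext_iff.1 ha a
  have hbAB : b ∈ B ∧ b ∉ A := by simpa using Finset.ext_iff.1 hb b
  have hxA : x ∉ A := fun h => by simpa using hA h
  have hxB : x ∉ B := fun h => by simpa using hB h
  set f : ℕ → ℕ := fun z => if z = x then 1 else if z = a then 2 else if z = b then k + 2 else
    if h : z ∈ A ∩ B then e ⟨z, h⟩ else 0 with hf
  have hfx : f x = 1 := by simp [hf]
  have hfa : f a = 2 := by
    have : a ≠ x := by rintro rfl; exact hxA haAB.1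
    simp [hf, this]
  have hfb : f b = k + 2 := by
    have hbx : b ≠ x := by rintro rfl; exact hxB hbAB.1
    have hba : b ≠ a := by rintro rfl; exact hbAB.2 haAB.1
    simp [hf, hbx, hba]
  have hfe : ∀ z (h : z ∈ A ∩ B), f z = e ⟨z, h⟩ := fun z h => by
    have hz := mem_inter.1 h
    have hzx : z ≠ x := by rintro rfl; exact hxA hz.1
    have hza : z ≠ a := by rintro rfl; exact haAB.2 hz.2
    have hzb : z ≠ b := by rintro rfl; exact hbAB.2 hz.1
    simp only [hf, if_neg hzx, if_neg hza, if_neg hzb, dif_pos h]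
  have hfIcc : ∀ z ∈ A ∩ B, 3 ≤ f z ∧ f z ≤ k + 1 := fun z h => by
    rw [hfe z h]; exact mem_Icc.1 (e ⟨z, h⟩).2
  have hinj : ∀ z ∈ A ∩ B, ∀ w ∈ A ∩ B, f z = f w → z = w := fun z hz w hw h => by
    rw [hfe z hz, hfe w hw] at h
    simpa using e.injective (Subtype.ext h)
  have hmem : ∀ z ∈ insert x (A ∪ B), z = x ∨ z = a ∨ z = b ∨ z ∈ A ∩ B := fun z hz => by
    rw [mem_insert, mem_union, hmemA, hmemB] at hz; tauto
  obtain ⟨σ, hσ, hσf⟩ := exists_perm_of_injOn (V := Icc 1 n) (S := insert x (A ∪ B)) (f := f)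
    (insert_subset hx (union_subset (hA.trans (erase_subset _ _)) (hB.trans (erase_subset _ _))))
    (fun z hz w hw h => by
      have := hfIcc z; have := hfIcc w; have := hinj z
      rcases hmem z hz with rfl | rfl | rfl | hz' <;> rcases hmem w hw with rfl | rfl | rfl | hw' <;>
        grind)
    (fun z hz => by
      rw [mem_coe, mem_Icc]
      rcases hmem z hz with rfl | rfl | rfl | hz'
      · omega
      · omega
      · omega
      · have := hfIcc z hz'; omega)
  refine ⟨σ, hσ, (hσf x (by simp)).trans hfx, ?_, ?_⟩
  · refine eq_of_subset_of_card_le (image_subset_iff.2 fun z hz => ?_) ?_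
    · rw [hσf z (by simp [hz]), mem_Icc]
      rcases (hmemA z).1 hz with rfl | h
      · omega
      · have := hfIcc z h; omega
    · rw [card_image_of_injective _ σ.injective, Nat.card_Icc]; omega
  · refine eq_of_subset_of_card_le (image_subset_iff.2 fun z hz => ?_) ?_
    · rw [hσf z (by simp [hz]), mem_Icc]
      rcases (hmemB z).1 hz with rfl | h
      · omega
      · have := hfIcc z h; omega
    · rw [card_image_of_injective _ σ.injective, Nat.card_Icc]; omega

lemma Jfam_two_nonMemberSubfamily : (Jfam n k 2).nonMemberSubfamily 1 =
    {Icc 2 (k + 1), Icc 3 (k + 2)} := by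
  ext T
  simp only [Jfam, mem_nonMemberSubfamily, mem_union, mem_insert, mem_singleton, mem_filter]
  constructor
  · rintro ⟨h | h, h1⟩
    · simpa [add_comm] using h
    · exact absurd h.2.1 h1
  · rintro (rfl | rfl)
    · simp
    · simp [add_comm]

lemma Jfam_two_subset (hkn : k + 2 ≤ n) : Jfam n k 2 ⊆ (Icc 1 n).powersetCard k := by
  intro T hT
  simp only [Jfam, mem_union, mem_insert, mem_singleton, mem_filter] at hT
  rcases hT with (rfl | rfl) | h
  · exact mem_powersetCard.2 ⟨Icc_subset_Icc (by omega) (by omega), by simp⟩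
  · exact mem_powersetCard.2 ⟨Icc_subset_Icc (by omega) (by omega), by simp⟩
  · exact h.1

lemma Jfam_two_crossIntersecting (hk : 2 ≤ k) : CrossIntersecting (Jfam n k 2) (Jfam n k 2) := by
  have h3 : (3 : ℕ) ∈ Icc 2 (k + 1) := by simp; omega
  have h3' : (3 : ℕ) ∈ Icc (2 + 1) (k + 2) := by simp; omega
  intro S hS T hT
  simp only [Jfam, mem_union, mem_insert, mem_singleton, mem_filter] at hS hT
  rcases hS with (rfl | rfl) | hS <;> rcases hT with (rfl | rfl) | hT
  · exact ⟨3, mem_inter.2 ⟨h3, h3⟩⟩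
  · exact ⟨3, mem_inter.2 ⟨h3, h3'⟩⟩
  · rw [inter_comm]; exact hT.2.2.1
  · exact ⟨3, mem_inter.2 ⟨h3', h3⟩⟩
  · exact ⟨3, mem_inter.2 ⟨h3', h3'⟩⟩
  · rw [inter_comm]; exact hT.2.2.2
  · exact hS.2.2.1
  · exact hS.2.2.2
  · exact ⟨1, mem_inter.2 ⟨hS.2.1, hT.2.1⟩⟩

lemma card_Jfam_two_le (hn : n = s + 2 + (u + 2)) :
    #(Jfam n (s + 2) 2) + (u + 1).choose (s + 1) + u.choose s ≤
      (s + 2 + (u + 1)).choose (s + 1) + 2 := by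
  refine ((Jfam_two_crossIntersecting (by omega)).card_le_of_nonMember_pair
    (Jfam_two_subset (by omega)) (by simp; omega) (by simp; omega) (fun h => ?_)
    Jfam_two_nonMemberSubfamily).1
  have : (2 : ℕ) ∈ Icc 3 (s + 2 + 2) := h ▸ by simp
  simp at this

lemma CrossIntersecting.isomorphicFam_Jfam (hF : F ⊆ (Icc 1 n).powersetCard (s + 2))
    (hFI : CrossIntersecting F F) (hx : x ∈ Icc 1 n) (hn : n = s + 2 + (u + 2)) (hAB : A ≠ B)
    (hxF : F.nonMemberSubfamily x = {A, B}) (hsu : s + 1 ≤ u)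
    (hcard : #F + (u + 1).choose (s + 1) + u.choose s = (s + 2 + (u + 1)).choose (s + 1) + 2) :
    IsomorphicFam n F (Jfam n (s + 2) 2) := by
  have hinter := (hFI.card_le_of_nonMember_pair hF hx (by simp; omega) hAB hxF).2 hsu hcard
  have hA : A ∈ F.nonMemberSubfamily x := by simp [hxF]
  have hB : B ∈ F.nonMemberSubfamily x := by simp [hxF]
  have hA' := mem_powersetCard.1 (nonMemberSubfamily_subset_powersetCard hF hA)
  have hB' := mem_powersetCard.1 (nonMemberSubfamily_subset_powersetCard hF hB)
  rw [mem_nonMemberSubfamily] at hA hB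
  obtain ⟨σ, hσ, hσx, hσA, hσB⟩ := exists_perm_standard (by omega) hx hA'.1 hB'.1 hA'.2 hB'.2
    (by omega)
  refine ⟨σ, hσ, eq_of_subset_of_card_le (image_subset_iff.2 fun T hT => ?_) ?_⟩
  · simp only [Jfam, mem_union, mem_insert, mem_singleton, mem_filter]
    by_cases hxT : x ∈ T
    · refine Or.inr ⟨mem_powersetCard.2 ⟨?_, ?_⟩, ?_, ?_, ?_⟩
      · rw [← hσ]; exact image_subset_image (mem_powersetCard.1 (hF hT)).1
      · rw [card_image_of_injective _ σ.injective, (mem_powersetCard.1 (hF hT)).2]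
      · rw [← hσx]; exact mem_image_of_mem _ hxT
      · rw [← hσA, ← image_inter _ _ σ.injective]; exact (hFI T hT A hA.1).image _
      · rw [← hσB, ← image_inter _ _ σ.injective]; exact (hFI T hT B hB.1).image _
    · have hTx : T ∈ F.nonMemberSubfamily x := mem_nonMemberSubfamily.2 ⟨hT, hxT⟩
      rw [hxF, mem_insert, mem_singleton] at hTx
      rcases hTx with rfl | rfl
      · exact Or.inl (Or.inl hσA)
      · exact Or.inl (Or.inr hσB)
  · rw [card_image_of_injective _ (image_injective σ.injective)]
    have := card_Jfam_two_le hn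
    omega

lemma two_le_card_nonMemberSubfamily_of_diversity (hγ : 2 ≤ diversity n F) (hx : x ∈ Icc 1 n) :
    2 ≤ #(F.nonMemberSubfamily x) := by
  have h1 : famDeg F x ≤ maxDeg n F := le_sup (f := famDeg F) hx
  have h2 : famDeg F x + #(F.nonMemberSubfamily x) = #F :=
    card_filter_add_card_filter_not (s := F) (x ∈ ·)
  unfold diversity at hγ
  omega

end TwoAvoiding

/-- the Han–Kohayakawa theorem (Theorem `thmhk`). -/
theorem statement10 (n k : ℕ) (hk : 4 ≤ k) (hn : 2 * k < n)
    (F : Finset (Finset ℕ)) (hF : F ⊆ (Finset.Icc 1 n).powersetCard k)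
    (hint : IntersectingFam F) (hγ : 2 ≤ diversity n F) :
    F.card ≤ Nat.choose (n - 1) (k - 1) - Nat.choose (n - k - 1) (k - 1) -
        Nat.choose (n - k - 2) (k - 2) + 2 ∧
    (5 ≤ k →
      F.card = Nat.choose (n - 1) (k - 1) - Nat.choose (n - k - 1) (k - 1) -
          Nat.choose (n - k - 2) (k - 2) + 2 →
      IsomorphicFam n F (Jfam n k 2)) := by
  obtain ⟨s, rfl⟩ := Nat.exists_eq_add_of_le' hk
  obtain ⟨u, rfl⟩ : ∃ u, n = s + 4 + (u + 2) := ⟨n - (s + 6), by omega⟩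
  rw [show s + 4 + (u + 2) - 1 = s + 4 + (u + 1) by omega, show s + 4 - 1 = s + 3 by omega,
    show s + 4 + (u + 2) - (s + 4) - 1 = u + 1 by omega,
    show s + 4 + (u + 2) - (s + 4) - 2 = u by omega, show s + 4 - 2 = s + 2 by omega]
  have hFI : CrossIntersecting F F := hint
  have hsub : (u + 1).choose (s + 3) + u.choose (s + 2) ≤ (s + 4 + (u + 1)).choose (s + 3) := by
    have h1 := Nat.choose_succ_succ (u + 1) (s + 2)
    have h2 := Nat.choose_le_choose (s + 2) (show u ≤ u + 1 by omega)
    have h3 := Nat.choose_le_choose (s + 3) (show u + 2 ≤ s + 4 + (u + 1) by omega)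
    rw [Nat.succ_eq_add_one, Nat.succ_eq_add_one, show u + 1 + 1 = u + 2 by omega,
      show s + 2 + 1 = s + 3 by omega] at h1
    omega
  by_cases h3 : ∀ x ∈ Icc 1 (s + 4 + (u + 2)), 3 ≤ #(F.nonMemberSubfamily x)
  · obtain ⟨hle, hlt⟩ := hFI.card_le_of_three_le hF (u := u) (by simp) (by omega) h3
    refine ⟨by omega, fun hs h => ?_⟩
    have := hlt (by omega) (by omega)
    omega
  · push Not at h3
    obtain ⟨x, hx, hx3⟩ := h3
    have hx2 := two_le_card_nonMemberSubfamily_of_diversity hγ hx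
    obtain ⟨A, B, hAB, hxF⟩ := card_eq_two.1 (show #(F.nonMemberSubfamily x) = 2 by omega)
    have hle := (hFI.card_le_of_nonMember_pair (s := s + 2) hF hx (u := u) (by simp) hAB hxF).1
    rw [show s + 2 + 2 = s + 4 by omega, show s + 2 + 1 = s + 3 by omega] at hle
    refine ⟨by omega, fun _ h => ?_⟩
    exact hFI.isomorphicFam_Jfam (s := s + 2) hF hx rfl hAB hxF (by omega) (by
      rw [show s + 2 + 2 = s + 4 by omega, show s + 2 + 1 = s + 3 by omega]; omega)
end
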